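/- arXiv:1302.5651 — 3 statements merged into one kernel-verified Lean document; each statement's English description precedes it below -/
import Mathlib

section
/- Let n ≤ ω and let M be a manifold modeled on the cube I^n (an I^n-manifold). Then every nowhere dense subset of M is contained in some spongy subset of M. -/
open Set Topology unitInterval

noncomputable section

/-! ### General notions -/

/-- `X` is completely metrizable: its topology is generated by a complete metric. -/
def CompletelyMetrizable (X : Type*) [t : TopologicalSpace X] : Prop :=
  ∃ m : MetricSpace X, m.toUniformSpace.toTopologicalSpace = t ∧
    @CompleteSpace X m.toUniformSpace

/-- The model cube `I^n` for `n ≤ ω`: `some k` codes the finite cube `I^k`,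
`none` codes the Hilbert cube `I^ω`. -/
def ModelCube : Option ℕ → Type
  | some k => Fin k → unitInterval
  | none => ℕ → unitInterval

instance : (n : Option ℕ) → TopologicalSpace (ModelCube n)
  | some k => inferInstanceAs (TopologicalSpace (Fin k → unitInterval))
  | none => inferInstanceAs (TopologicalSpace (ℕ → unitInterval))

/-- A manifold modeled on `E`: a paracompact space each point of which has an open
neighborhood homeomorphic to an open subset of `E`. -/
def IsManifoldModeledOn (M : Type*) [TopologicalSpace M] (E : Type*) [TopologicalSpace E] :
    Prop :=
  ParacompactSpace M ∧
    ∀ x : M, ∃ O : Set M, IsOpen O ∧ x ∈ O ∧ ∃ U : Set E, IsOpen U ∧ Nonempty (↥O ≃ₜ ↥U)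

/-- The pair `(X, A)` is homeomorphic to the pair `(Y, B)`. -/
def PairHomeo {X Y : Type*} [TopologicalSpace X] [TopologicalSpace Y]
    (A : Set X) (B : Set Y) : Prop :=
  ∃ e : X ≃ₜ Y, ⇑e '' A = B

/-- The cube `I^n` sitting inside `ℝ^n`. -/
def stdCube (n : ℕ) : Set (Fin n → ℝ) := {f | ∀ i, f i ∈ Icc (0 : ℝ) 1}

/-- The copy of `I^ω × [0,1]` sitting inside `I^ω × [0,2)`. -/
def hilbertCollar : Set ((ℕ → unitInterval) × ↥(Ico (0 : ℝ) 2)) := {p | (p.2 : ℝ) ≤ 1}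

/-- The Hilbert cube `I^ω`. -/
abbrev HilbertCube : Type := ℕ → unitInterval

/-- The space `I^ω × [0,1)`. -/
abbrev HilbertHalfOpen : Type := HilbertCube × ↥(Ico (0 : ℝ) 1)

/-- `B` is a tame ball in the `I^n`-manifold `M`: it has an open neighborhood `O` such
that the pair `(O, B)` is homeomorphic to `(ℝ^n, I^n)` (for finite `n`), resp. to
`(I^ω × [0,2), I^ω × [0,1])` (for `n = ω`). -/
def IsTameBall (n : Option ℕ) {M : Type*} [TopologicalSpace M] (B : Set M) : Prop :=
  ∃ O : Set M, IsOpen O ∧ B ⊆ O ∧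
    match n with
    | some k => PairHomeo {x : ↥O | (x : M) ∈ B} (stdCube k)
    | none => PairHomeo {x : ↥O | (x : M) ∈ B} hilbertCollar

/-- The family of all tame balls of the `I^n`-manifold `X`. -/
def tameBalls (n : Option ℕ) (X : Type*) [TopologicalSpace X] : Set (Set X) :=
  {B | IsTameBall n B}

/-- A family of subsets of `X` is vanishing if for any open cover `𝒰` of `X` the subfamily
of sets contained in no member of `𝒰` is locally finite in `X`. -/
def VanishingFamily {X : Type*} [TopologicalSpace X] (F : Set (Set X)) : Prop :=
  ∀ 𝒰 : Set (Set X), (∀ u ∈ 𝒰, IsOpen u) → ⋃₀ 𝒰 = univ →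
    LocallyFinite (fun A : {A : Set X // A ∈ F ∧ ∀ u ∈ 𝒰, ¬ A ⊆ u} => (A : Set X))

/-- The family of connected components of the complement of `S`. -/
def complComponents {X : Type*} [TopologicalSpace X] (S : Set X) : Set (Set X) :=
  {C | ∃ x ∈ Sᶜ, C = connectedComponentIn Sᶜ x}

/-- A spongy subset of an `I^n`-manifold. -/
def IsSpongy (n : Option ℕ) {M : Type*} [TopologicalSpace M] (S : Set M) : Prop :=
  IsClosed S ∧ IsNowhereDense S ∧
  VanishingFamily (complComponents S) ∧
  (∀ C ∈ complComponents S, ∀ C' ∈ complComponents S, C ≠ C' →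
    closure C ∩ closure C' = ∅) ∧
  ∀ C ∈ complComponents S, IsTameBall n (closure C)

/-- `S` is a universal nowhere dense subset of `M`. -/
def UniversalNowhereDense {M : Type*} [TopologicalSpace M] (S : Set M) : Prop :=
  IsNowhereDense S ∧ ∀ A : Set M, IsNowhereDense A → ∃ h : M ≃ₜ M, ⇑h '' A ⊆ S

/-- `(f, g) ≺ 𝒜` : for each `z` with `f z ≠ g z` the doubleton `{f z, g z}` lies in some
member of `𝒜`. -/
def Near {Z X : Type*} (f g : Z → X) (𝒜 : Set (Set X)) : Prop :=
  ∀ z : Z, f z ≠ g z → ∃ A ∈ 𝒜, f z ∈ A ∧ g z ∈ A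

/-- The star `St(A, 𝒰)` of a set `A` with respect to a family `𝒰`. -/
def covStar {X : Type*} (A : Set X) (𝒰 : Set (Set X)) : Set X :=
  ⋃₀ {u ∈ 𝒰 | (u ∩ A).Nonempty}

/-- A compact set `K ⊆ X` is locally shrinkable if for each open neighborhood `O` of `K`
and each open cover `𝒱` of `O` there is a homeomorphism of `X` supported in `O` moving `K`
into a member of `𝒱`. -/
def LocallyShrinkable {X : Type*} [TopologicalSpace X] (K : Set X) : Prop :=
  ∀ O : Set X, IsOpen O → K ⊆ O →
    ∀ 𝒱 : Set (Set X), (∀ v ∈ 𝒱, IsOpen v ∧ v ⊆ O) → O ⊆ ⋃₀ 𝒱 →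
      ∃ h : X ≃ₜ X, (∀ x ∉ O, h x = x) ∧ ∃ v ∈ 𝒱, ⇑h '' K ⊆ v

/-- A family of sets is ambiently invariant if it is invariant under images of
homeomorphisms of the ambient space. -/
def AmbientlyInvariant {X : Type*} [TopologicalSpace X] (𝒦 : Set (Set X)) : Prop :=
  ∀ h : X ≃ₜ X, ∀ K ∈ 𝒦, ⇑h '' K ∈ 𝒦

/-- The local shift property of a family of sets. -/
def LocalShiftProperty {X : Type*} [TopologicalSpace X] (𝒦 : Set (Set X)) : Prop :=
  ∀ x : X, ∀ O ∈ 𝓝 x, ∃ U ∈ 𝓝 x, U ⊆ O ∧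
    ∀ A ∈ 𝒦, ∀ B ∈ 𝒦, A ⊆ U → B ⊆ U →
      ∃ h : X ≃ₜ X, ⇑h '' A = B ∧ ∀ y ∉ O, h y = y

/-- A tame family of compact subsets of `X`. -/
def IsTameFamily {X : Type*} [TopologicalSpace X] (𝒦 : Set (Set X)) : Prop :=
  (∀ K ∈ 𝒦, IsCompact K) ∧ AmbientlyInvariant 𝒦 ∧ (∀ K ∈ 𝒦, LocallyShrinkable K) ∧
    LocalShiftProperty 𝒦 ∧ ∀ U : Set X, IsOpen U → U.Nonempty → ∃ K ∈ 𝒦, K ⊆ U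

/-- `X` is strongly locally homogeneous. -/
def StronglyLocallyHomogeneous (X : Type*) [TopologicalSpace X] : Prop :=
  ∀ x : X, ∀ O ∈ 𝓝 x, ∃ U ∈ 𝓝 x, U ⊆ O ∧
    ∀ y ∈ U, ∃ h : X ≃ₜ X, h x = y ∧ ∀ z ∉ O, h z = z

/-- `X` is topologically homogeneous. -/
def TopologicallyHomogeneous (X : Type*) [TopologicalSpace X] : Prop :=
  ∀ x y : X, ∃ h : X ≃ₜ X, h x = y

/-- `A` is σ-discrete in `X`: a countable union of closed discrete subsets of `X`. -/
def SigmaDiscrete {X : Type*} [TopologicalSpace X] (A : Set X) : Prop :=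
  ∃ f : ℕ → Set X, A = ⋃ n, f n ∧ ∀ n, IsClosed (f n) ∧ DiscreteTopology ↥(f n)

/-! ### Decompositions -/

/-- A decomposition of a topological space `X`: a cover of `X` by pairwise disjoint
nonempty compact subsets. -/
structure Decomposition (X : Type*) [TopologicalSpace X] where
  pieces : Set (Set X)
  nonempty' : ∀ A ∈ pieces, A.Nonempty
  isCompact' : ∀ A ∈ pieces, IsCompact A
  disjoint' : ∀ A ∈ pieces, ∀ B ∈ pieces, A ≠ B → Disjoint A B
  covers : ∀ x : X, ∃ A ∈ pieces, x ∈ A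

namespace Decomposition

variable {X : Type*} [TopologicalSpace X] (D : Decomposition X)

/-- The decomposition space `X/D` (as a set it is the set of pieces). -/
def Space : Type _ := {A : Set X // A ∈ D.pieces}

/-- The quotient map `q_D : X → X/D`. -/
noncomputable def q (x : X) : D.Space := ⟨(D.covers x).choose, (D.covers x).choose_spec.1⟩

/-- The quotient topology on the decomposition space. -/
instance : TopologicalSpace D.Space := TopologicalSpace.coinduced D.q inferInstance

/-- The non-degeneracy part `D°` of a decomposition, viewed inside the decomposition
space. -/
def nondeg : Set D.Space := {A | ¬ (A.1 : Set X).Subsingleton}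

/-- The union of the non-degenerate pieces of a decomposition. -/
def nondegUnion : Set X := ⋃₀ {A ∈ D.pieces | ¬ A.Subsingleton}

/-- A `D`-saturated subset of `X`. -/
def Saturated (U : Set X) : Prop := ∀ A ∈ D.pieces, (A ∩ U).Nonempty → A ⊆ U

/-- A decomposition is upper semicontinuous if saturations of closed sets are closed. -/
def IsUSC : Prop :=
  ∀ F : Set X, IsClosed F → IsClosed (⋃₀ {A ∈ D.pieces | (A ∩ F).Nonempty})

/-- A decomposition is vanishing if for every open cover `𝒰` of `X` the family of pieces
contained in no member of `𝒰` is discrete in `X`. -/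
def Vanishing : Prop :=
  ∀ 𝒰 : Set (Set X), (∀ u ∈ 𝒰, IsOpen u) → ⋃₀ 𝒰 = univ →
    ∀ x : X, ∃ V ∈ 𝓝 x, ∀ A ∈ D.pieces, (∀ u ∈ 𝒰, ¬ A ⊆ u) →
      ∀ B ∈ D.pieces, (∀ u ∈ 𝒰, ¬ B ⊆ u) →
        (V ∩ A).Nonempty → (V ∩ B).Nonempty → A = B

/-- The restriction of `D` to a (`D`-saturated open) set `U` is shrinkable: for each
`D`-saturated open cover `𝒰` of `U` and each open cover `𝒱` of `U` there is a
homeomorphism `h` of the subspace `U` with `(h, id) ≺ 𝒰` and `{h(A) : A ∈ D, A ⊆ U} ≺ 𝒱`. -/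
def ShrinkableOn (U : Set X) : Prop :=
  ∀ 𝒰 : Set (Set X),
    (∀ u ∈ 𝒰, IsOpen u ∧ u ⊆ U ∧ ∀ A ∈ D.pieces, A ⊆ U → (A ∩ u).Nonempty → A ⊆ u) →
    U ⊆ ⋃₀ 𝒰 →
    ∀ 𝒱 : Set (Set X), (∀ v ∈ 𝒱, IsOpen v ∧ v ⊆ U) → U ⊆ ⋃₀ 𝒱 →
      ∃ h : ↥U ≃ₜ ↥U,
        Near (fun x : ↥U => (h x : X)) (fun x : ↥U => (x : X)) 𝒰 ∧
        ∀ A ∈ D.pieces, A ⊆ U →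
          ∃ v ∈ 𝒱, (fun x : ↥U => (x : X)) '' (⇑h '' {x : ↥U | (x : X) ∈ A}) ⊆ v

/-- A decomposition is strongly shrinkable if its restriction to any `D`-saturated open
set is shrinkable. -/
def StronglyShrinkable : Prop :=
  ∀ U : Set X, IsOpen U → D.Saturated U → D.ShrinkableOn U

/-- A decomposition is `𝒦`-tame if it is vanishing, strongly shrinkable, and all its
non-degenerate pieces belong to `𝒦`. -/
def KTame (𝒦 : Set (Set X)) : Prop :=
  D.Vanishing ∧ D.StronglyShrinkable ∧ ∀ A ∈ D.pieces, ¬ A.Subsingleton → A ∈ 𝒦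

/-- A decomposition is dense if its non-degeneracy part is dense in the decomposition
space. -/
def IsDenseDecomp : Prop := Dense D.nondeg

/-- A decomposition is discrete if its non-degeneracy part is closed and discrete in
the decomposition space. -/
def IsDiscreteDecomp : Prop := IsClosed D.nondeg ∧ DiscreteTopology ↥D.nondeg

end Decomposition

/-- A homeomorphism `φ : X/A → X/B` is `(A,B)`-liftable if it lifts to a homeomorphism
`Φ : X → X` with `q_B ∘ Φ = φ ∘ q_A`. -/
def Liftable {X : Type*} [TopologicalSpace X] (A B : Decomposition X)
    (φ : A.Space ≃ₜ B.Space) : Prop :=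
  ∃ Φ : X ≃ₜ X, ∀ x : X, B.q (Φ x) = φ (A.q x)

/-- Two decompositions of `X` are topologically equivalent if some homeomorphism of `X`
maps the first family of pieces onto the second. -/
def TopEquivDecomp {X : Type*} [TopologicalSpace X] (A B : Decomposition X) : Prop :=
  ∃ Φ : X ≃ₜ X, (fun S : Set X => ⇑Φ '' S) '' A.pieces = B.pieces

/-- A `𝒦`-spongy subset of `X`. -/
def IsKSpongy {X : Type*} [TopologicalSpace X] (𝒦 : Set (Set X)) (S : Set X) : Prop :=
  ∃ D : Decomposition X, D.KTame 𝒦 ∧ D.IsDenseDecomp ∧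
    Sᶜ = ⋃ A ∈ D.pieces, interior A

/-! ### Shape notions -/

/-- `K` is point-like in `X`. -/
def PointLike {X : Type*} [TopologicalSpace X] (K : Set X) : Prop :=
  ∀ N : Set X, IsClosed N → K ⊆ interior N →
    ∃ x ∈ interior N, Nonempty (↥(N \ K) ≃ₜ ↥(N \ {x}))

/-- `K` is contractible in `U`: the inclusion `K ↪ U` is homotopic to a constant map. -/
def ContractibleIn {X : Type*} [TopologicalSpace X] (K U : Set X) : Prop :=
  ∃ hKU : K ⊆ U, ∃ y : ↥U,
    (ContinuousMap.mk (Set.inclusion hKU) (continuous_inclusion hKU)).Homotopic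
      (ContinuousMap.const ↥K y)

/-- `K` is cell-like in `X`: `K` is contractible in each of its neighborhoods. -/
def CellLike {X : Type*} [TopologicalSpace X] (K : Set X) : Prop :=
  ∀ U : Set X, IsOpen U → K ⊆ U → ContractibleIn K U

/-- `K` is cellular (with model `E`): every neighborhood of `K` contains a neighborhood
of `K` homeomorphic to `E`. -/
def CellularIn (E : Type*) [TopologicalSpace E] {X : Type*} [TopologicalSpace X]
    (K : Set X) : Prop :=
  ∀ U : Set X, IsOpen U → K ⊆ U → ∃ V ∈ 𝓝ˢ K, V ⊆ U ∧ Nonempty (↥V ≃ₜ E)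

/-- `X` is locally contractible. -/
def LocallyContractible (X : Type*) [TopologicalSpace X] : Prop :=
  ∀ x : X, ∀ U ∈ 𝓝 x, ∃ V ∈ 𝓝 x, V ⊆ U ∧ ContractibleIn V U


/-- If `Sᶜ` is a union of pairwise disjoint open connected sets, then these sets are exactly
the connected components of `Sᶜ`. -/
theorem exists_eq_of_mem_complComponents {M κ : Type*} [TopologicalSpace M] {c : κ → Set M}
    {S : Set M} (hS : Sᶜ = ⋃ k, c k) (ho : ∀ k, IsOpen (c k))
    (hc : ∀ k, IsPreconnected (c k)) (hd : Pairwise fun k l => Disjoint (c k) (c l))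
    {C : Set M} (hC : C ∈ complComponents S) : ∃ k, C = c k := by
  obtain ⟨x, hx, rfl⟩ := hC
  have hx' := hx
  rw [hS] at hx'
  obtain ⟨k, hk⟩ := mem_iUnion.1 hx'
  refine ⟨k, Subset.antisymm ?_ ?_⟩
  · refine isPreconnected_connectedComponentIn.subset_left_of_subset_union (ho k)
      (isOpen_biUnion fun l (_ : l ∈ {l | l ≠ k}) => ho l) ?_ ?_
      ⟨x, mem_connectedComponentIn hx, hk⟩
    · rw [disjoint_iUnion₂_right]
      exact fun l hl => hd (Ne.symm hl)
    · refine (connectedComponentIn_subset _ _).trans ?_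
      rw [hS]
      refine iUnion_subset fun l => ?_
      by_cases h : l = k
      · exact h ▸ subset_union_left
      · exact (subset_biUnion_of_mem (u := c) (show l ∈ {l | l ≠ k} from h)).trans
          subset_union_right
  · exact (hc k).subset_connectedComponentIn hk (hS ▸ subset_iUnion c k)

/-- Greedy selection of a sequence of sets with pairwise disjoint closures that meets every
member of a prescribed sequence of open sets. -/
theorem exists_seq_disjoint_closure {M : Type*} [TopologicalSpace M]
    {G : Set M} (hG : IsOpen G) {b : ℕ → Set M} (hb : ∀ j, IsOpen (b j))
    {P : ℕ → Set M → Prop}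
    (h : ∀ j U, IsOpen U → U ⊆ G → U.Nonempty → ∃ C, P j C ∧ C.Nonempty ∧ closure C ⊆ U) :
    ∃ C : ℕ → Set M, (∀ j, C j = ∅ ∨ P j (C j) ∧ closure (C j) ⊆ G) ∧
      (Pairwise fun i j => Disjoint (closure (C i)) (closure (C j))) ∧
      ∀ j, (b j ∩ G).Nonempty → ∃ i, (C i ∩ b j).Nonempty := by
  have step : ∀ (j : ℕ) (R : TopologicalSpace.Closeds M), ∃ C : Set M,
      (C = ∅ ∨ P j C ∧ closure C ⊆ G) ∧ Disjoint (R : Set M) (closure C) ∧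
      ((b j ∩ G).Nonempty → (((R : Set M) ∪ C) ∩ b j).Nonempty) := by
    intro j R
    by_cases hne : ((b j ∩ G) \ R).Nonempty
    · obtain ⟨C, hP, hCn, hC⟩ := h j _ (((hb j).inter hG).sdiff R.isClosed)
        (sdiff_subset.trans inter_subset_right) hne
      refine ⟨C, .inr ⟨hP, hC.trans (sdiff_subset.trans inter_subset_right)⟩,
        disjoint_right.2 fun x hx => (hC hx).2, fun _ => ?_⟩
      obtain ⟨x, hx⟩ := hCn
      exact ⟨x, .inr hx, (hC (subset_closure hx)).1.1⟩
    · refine ⟨∅, .inl rfl, by simp, fun ⟨x, hx⟩ => ⟨x, .inl ?_, hx.1⟩⟩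
      by_contra hxR
      exact hne ⟨x, hx, hxR⟩
  choose F hF1 hF2 hF3 using step
  let R : ℕ → TopologicalSpace.Closeds M :=
    Nat.rec ⊥ fun j R => R ⊔ TopologicalSpace.Closeds.closure (F j R)
  have hR : ∀ j, R (j + 1) = R j ⊔ TopologicalSpace.Closeds.closure (F j (R j)) := fun j => rfl
  have hsub : ∀ j i, i < j → closure (F i (R i)) ⊆ SetLike.coe (R j) := by
    intro j
    induction j with
    | zero => intro i hi; omega
    | succ j ih =>
      intro i hi
      rw [hR, TopologicalSpace.Closeds.coe_sup]
      rcases Nat.lt_succ_iff_lt_or_eq.1 hi with h | rfl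
      · exact (ih i h).trans subset_union_left
      · exact subset_union_right
  have hsup : ∀ j x, x ∈ R j → ∃ i, x ∈ closure (F i (R i)) := by
    intro j
    induction j with
    | zero => intro x hx; exact absurd (show x ∈ (∅ : Set M) from hx) (notMem_empty x)
    | succ j ih =>
      intro x hx
      rw [hR] at hx
      rcases hx with hx | hx
      · exact ih x hx
      · exact ⟨j, hx⟩
  refine ⟨fun j => F j (R j), fun j => hF1 j _, ?_, fun j hj => ?_⟩
  · refine (pairwise_disjoint_on fun j => closure (F j (R j))).2 fun i j hij => ?_
    exact (hF2 j (R j)).mono_left (hsub j i hij)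
  · obtain ⟨x, hx, hxb⟩ := hF3 j (R j) hj
    have : ∃ i, x ∈ closure (F i (R i)) := by
      rcases hx with hx | hx
      · exact hsup j x hx
      · exact ⟨j, subset_closure hx⟩
    obtain ⟨i, hi⟩ := this
    obtain ⟨y, hy⟩ := mem_closure_iff.1 hi _ (hb j) hxb
    exact ⟨i, y, hy.2, hy.1⟩

/-- For a locally finite open cover, the set of indices of the members containing a given point
is locally constant on a dense open set. -/
theorem exists_open_subset_const_index {M ι : Type*} [TopologicalSpace M] {V : ι → Set M}
    (hV : ∀ i, IsOpen (V i)) (hlf : LocallyFinite V) {U : Set M} (hU : IsOpen U)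
    (hne : U.Nonempty) :
    ∃ T : Set ι, (U ∩ interior {x | {i | x ∈ V i} = T}).Nonempty := by
  obtain ⟨x, hx⟩ := hne
  obtain ⟨N, hN, hfin⟩ := hlf x
  have hW : IsOpen (U ∩ interior N) := hU.inter isOpen_interior
  set W := U ∩ interior N
  have hxW : x ∈ W := ⟨hx, mem_interior_iff_mem_nhds.2 hN⟩
  have hsub : ∀ y ∈ W, {i | y ∈ V i} ⊆ {i | (V i ∩ N).Nonempty} :=
    fun y hy i hi => ⟨y, hi, interior_subset hy.2⟩
  have hfin' : ((fun y => {i | y ∈ V i}) '' W).Finite := by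
    refine hfin.finite_subsets.subset ?_
    rintro _ ⟨y, hy, rfl⟩
    exact hsub y hy
  obtain ⟨T, ⟨⟨y, hy, hyT⟩, hmax⟩⟩ := hfin'.exists_maximal ⟨_, mem_image_of_mem _ hxW⟩
  have hTfin : T.Finite := hyT ▸ hfin.subset (hsub y hy)
  refine ⟨T, y, hy.1, mem_interior.2 ⟨W ∩ ⋂ i ∈ T, V i, ?_,
    hW.inter (hTfin.isOpen_biInter fun i _ => hV i), hy, ?_⟩⟩
  · rintro z ⟨hz, hzT⟩
    have hle : T ≤ {i | z ∈ V i} := fun i hi => mem_iInter₂.1 hzT i hi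
    exact Subset.antisymm (hmax (mem_image_of_mem _ hz) hle) hle
  · rw [← hyT]
    exact mem_iInter₂.2 fun i hi => hi

/-- A compact set whose points lie in the same members of a cover by open sets of Hausdorff
charts is closed, even if the ambient space is not Hausdorff. -/
theorem isClosed_of_isCompact_of_const_index {M X ι : Type*} [TopologicalSpace M]
    [TopologicalSpace X] [T2Space X] {V : ι → Set M} (hV : ∀ i, IsOpen (V i))
    (hcov : ⋃ i, V i = univ) (e : ι → OpenPartialHomeomorph M X)
    (he : ∀ i, V i ⊆ (e i).source) {T : Set ι} {B : Set M} (hB : IsCompact B)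
    (hBT : B ⊆ {x | {i | x ∈ V i} = T}) : IsClosed B := by
  refine isClosed_of_closure_subset fun y hy => ?_
  obtain ⟨i, hi⟩ := mem_iUnion.1 (hcov ▸ mem_univ y)
  obtain ⟨z, hzV, hzB⟩ := mem_closure_iff.1 hy _ (hV i) hi
  have hiT : i ∈ T := by rw [← hBT hzB]; exact hzV
  have hBV : B ⊆ V i := fun w hw => by
    have := hBT hw
    rw [← this] at hiT
    exact hiT
  have hcl : IsClosed (e i '' B) :=
    (hB.image_of_continuousOn ((e i).continuousOn.mono (hBV.trans (he i)))).isClosed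
  by_contra hyB
  have hyim : e i y ∉ e i '' B := by
    rintro ⟨w, hw, hwy⟩
    exact hyB ((e i).injOn (he i (hBV hw)) (he i hi) hwy ▸ hw)
  obtain ⟨w, hw, hwB⟩ := mem_closure_iff.1 hy _
    ((e i).isOpen_inter_preimage hcl.isOpen_compl) ⟨he i hi, hyim⟩
  exact hw.2 (mem_image_of_mem _ hwB)

/-- In a paracompact space locally modeled on a separable metric space, a family of arbitrarily
small tame balls suffices to enlarge every nowhere dense set to a spongy set. -/
theorem exists_isSpongy_of_charts (n : Option ℕ) {M X : Type*} [TopologicalSpace M]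
    [ParacompactSpace M] [MetricSpace X] [SecondCountableTopology X]
    (hch : ∀ x : M, ∃ e : OpenPartialHomeomorph M X, x ∈ e.source)
    (hball : ∀ U : Set M, IsOpen U → U.Nonempty → ∃ C B : Set M, IsOpen C ∧ IsPreconnected C ∧
      C.Nonempty ∧ C ⊆ B ∧ B ⊆ closure C ∧ IsCompact B ∧ B ⊆ U ∧ IsTameBall n B)
    {A : Set M} (hA : IsNowhereDense A) : ∃ S : Set M, IsSpongy n S ∧ A ⊆ S := by
  choose e he using hch
  obtain ⟨V, hVo, hVcov, hVlf, hVe⟩ := precise_refinement (fun x => (e x).source)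
    (fun x => (e x).open_source) (eq_univ_of_forall fun x => mem_iUnion.2 ⟨x, he x⟩)
  let H : Set M → Set M := fun T => {x | {i | x ∈ V i} = T}
  let G : Set M → Set M := fun T => interior (H T) \ closure A
  have hGo : ∀ T, IsOpen (G T) := fun T => isOpen_interior.sdiff isClosed_closure
  have hGH : ∀ T, G T ⊆ H T := fun T => sdiff_subset.trans interior_subset
  have hHV : ∀ T i, i ∈ T → H T ⊆ V i := by
    intro T i hi x hx
    have hx : {i | x ∈ V i} = T := hx
    rw [← hx] at hi
    exact hi
  let P : Set M → ℕ → Set M → Prop := fun T j C => IsOpen C ∧ IsPreconnected C ∧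
    IsTameBall n (closure C) ∧ ∀ i ∈ T, ∀ x ∈ C, ∀ y ∈ C, dist (e i x) (e i y) < (1 / 2) ^ j
  have hP : ∀ T j U, IsOpen U → U ⊆ G T → U.Nonempty →
      ∃ C, P T j C ∧ C.Nonempty ∧ closure C ⊆ U := by
    rintro T j U hU hUG ⟨x, hx⟩
    have hTfin : T.Finite := by
      have hxT : {i | x ∈ V i} = T := hGH T (hUG hx)
      exact hxT ▸ hVlf.point_finite x
    have hsmall : ∀ᶠ y in 𝓝 x, ∀ i ∈ T, dist (e i y) (e i x) < (1 / 2) ^ j / 2 := by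
      refine (Filter.eventually_all_finite hTfin).2 fun i hi => ?_
      have hxs : x ∈ (e i).source := hVe i (hHV T i hi (hGH T (hUG hx)))
      exact ((e i).continuousAt hxs).eventually (Metric.ball_mem_nhds _ (by positivity))
    obtain ⟨W, hW, hWo, hxW⟩ := eventually_nhds_iff.1 hsmall
    obtain ⟨C, B, hCo, hCc, hCn, hCB, hBC, hBk, hBU, hBt⟩ :=
      hball (U ∩ W) (hU.inter hWo) ⟨x, hx, hxW⟩
    have hBcl : IsClosed B := isClosed_of_isCompact_of_const_index hVo hVcov e hVe hBk
      (hBU.trans (inter_subset_left.trans (hUG.trans (hGH T))))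
    have hclC : closure C = B := Subset.antisymm (closure_minimal hCB hBcl) hBC
    refine ⟨C, ⟨hCo, hCc, hclC ▸ hBt, fun i hi y hy z hz => ?_⟩, hCn,
      hclC ▸ hBU.trans inter_subset_left⟩
    have h1 := hW y (hBU (hCB hy)).2 i hi
    have h2 := hW z (hBU (hCB hz)).2 i hi
    calc dist (e i y) (e i z) ≤ dist (e i y) (e i x) + dist (e i z) (e i x) :=
          dist_triangle_right _ _ _
      _ < _ := by linarith
  have hsel : ∀ T, ∃ C : ℕ → Set M, (∀ j, C j = ∅ ∨ P T j (C j) ∧ closure (C j) ⊆ G T) ∧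
      (Pairwise fun i j => Disjoint (closure (C i)) (closure (C j))) ∧
      ∀ U, IsOpen U → (U ∩ G T).Nonempty → ∃ j, (C j ∩ U).Nonempty := by
    intro T
    by_cases hne : T.Nonempty
    · obtain ⟨i, hi⟩ := hne
      have := (e i).secondCountableTopology_source
      have hbasis := TopologicalSpace.isBasis_countableBasis (e i).source
      obtain ⟨b, hb⟩ := ((TopologicalSpace.countable_countableBasis (e i).source).insert
        ∅).exists_eq_range (insert_nonempty _ _)
      have hbo : ∀ j, IsOpen (b j) := fun j => by
        rcases (hb ▸ mem_range_self j : b j ∈ insert ∅ _) with h | h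
        · rw [h]; exact isOpen_empty
        · exact hbasis.isOpen h
      obtain ⟨C, hC, hCd, hCm⟩ := exists_seq_disjoint_closure (hGo T)
        (b := fun j => Subtype.val '' b j)
        (fun j => (e i).open_source.isOpenMap_subtype_val _ (hbo j)) (hP T)
      refine ⟨C, hC, hCd, fun U hU ⟨x, hxU, hxG⟩ => ?_⟩
      have hxs : x ∈ (e i).source := hVe i (hHV T i hi (hGH T hxG))
      obtain ⟨t, ht, hxt, htU⟩ := hbasis.exists_subset_of_mem_open
        (show (⟨x, hxs⟩ : (e i).source) ∈ Subtype.val ⁻¹' (U ∩ G T) from ⟨hxU, hxG⟩)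
        ((hU.inter (hGo T)).preimage continuous_subtype_val)
      obtain ⟨j, rfl⟩ := (hb ▸ mem_insert_of_mem _ ht : t ∈ range b)
      obtain ⟨k, y, hyC, z, hz, rfl⟩ := hCm j ⟨x, ⟨⟨x, hxs⟩, hxt, rfl⟩, hxG⟩
      exact ⟨k, z, hyC, (htU hz).1⟩
    · refine ⟨fun _ => ∅, fun _ => .inl rfl, fun _ _ _ => by simp, fun U _ ⟨x, _, hx⟩ => ?_⟩
      obtain ⟨i, hi⟩ := mem_iUnion.1 (hVcov ▸ mem_univ x)
      have hxT : {i | x ∈ V i} = T := hGH T hx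
      exact absurd ⟨i, hxT ▸ hi⟩ hne
  choose C hC hCd hCm using hsel
  have hCP : ∀ T j, IsOpen (C T j) ∧ IsPreconnected (C T j) ∧ closure (C T j) ⊆ G T := by
    intro T j
    rcases hC T j with h | h
    · simp [h, isPreconnected_empty]
    · exact ⟨h.1.1, h.1.2.1, h.2⟩
  have hdisj : Pairwise fun p q : Set M × ℕ =>
      Disjoint (closure (C p.1 p.2)) (closure (C q.1 q.2)) := by
    rintro ⟨T, j⟩ ⟨T', j'⟩ hne
    by_cases hT : T = T'
    · subst hT
      exact hCd T fun h => hne (Prod.ext rfl h)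
    · refine disjoint_left.2 fun x hx hx' => hT ?_
      have h1 : {i | x ∈ V i} = T := hGH _ ((hCP T j).2.2 hx)
      have h2 : {i | x ∈ V i} = T' := hGH _ ((hCP T' j').2.2 hx')
      exact h1.symm.trans h2
  let c : Set M × ℕ → Set M := fun p => C p.1 p.2
  have hco : ∀ p, IsOpen (c p) := fun p => (hCP p.1 p.2).1
  have hdense : Dense (⋃ p, c p) := by
    rw [dense_iff_inter_open]
    intro U hU hne
    have hne' : (U ∩ (closure A)ᶜ).Nonempty :=
      (interior_eq_empty_iff_dense_compl.1 hA).inter_open_nonempty U hU hne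
    obtain ⟨T, x, hx, hxT⟩ := exists_open_subset_const_index hVo hVlf
      (hU.inter isClosed_closure.isOpen_compl) hne'
    obtain ⟨j, y, hy, hyU⟩ := hCm T U hU ⟨x, hx.1, hxT, hx.2⟩
    exact ⟨y, hyU, mem_iUnion.2 ⟨(T, j), hy⟩⟩
  have hScl : IsClosed (⋃ p, c p)ᶜ := (isOpen_iUnion hco).isClosed_compl
  have hcomp : ∀ D ∈ complComponents (⋃ p, c p)ᶜ, ∃ p, D = c p := fun D hD =>
    exists_eq_of_mem_complComponents (compl_compl _) hco (fun p => (hCP p.1 p.2).2.1)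
      (fun p q hpq => (hdisj hpq).mono subset_closure subset_closure) hD
  refine ⟨(⋃ p, c p)ᶜ, ⟨hScl, ?_, ?_, ?_, ?_⟩, ?_⟩
  · rw [hScl.isNowhereDense_iff, interior_eq_empty_iff_dense_compl, compl_compl]
    exact hdense
  · intro 𝒰 h𝒰o h𝒰 x
    obtain ⟨u, hu, hxu⟩ := mem_sUnion.1 (h𝒰 ▸ mem_univ x)
    obtain ⟨N, hN, hNfin⟩ := hVlf x
    obtain ⟨i, hi⟩ := mem_iUnion.1 (hVcov ▸ mem_univ x)
    have hxs := hVe i hi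
    have hnhds : (e i).target ∩ (e i).symm ⁻¹' u ∈ 𝓝 (e i x) :=
      ((e i).symm.isOpen_inter_preimage (h𝒰o u hu)).mem_nhds
        ⟨(e i).map_source hxs, by simpa [(e i).left_inv hxs] using hxu⟩
    obtain ⟨ε, hε, hball⟩ := Metric.mem_nhds_iff.1 hnhds
    obtain ⟨m, hm⟩ := exists_pow_lt_of_lt_one (half_pos hε) (by norm_num : (1 / 2 : ℝ) < 1)
    refine ⟨N ∩ (V i ∩ e i ⁻¹' Metric.ball (e i x) (ε / 2)), Filter.inter_mem hN
      (Filter.inter_mem ((hVo i).mem_nhds hi)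
        ((e i).continuousAt hxs (Metric.ball_mem_nhds _ (half_pos hε)))), ?_⟩
    have hfin : (c '' ({T | T ⊆ {i | (V i ∩ N).Nonempty}} ×ˢ Iio m)).Finite :=
      (hNfin.finite_subsets.prod (finite_Iio m)).image c
    refine (hfin.preimage Subtype.val_injective.injOn).subset ?_
    rintro ⟨D, hD, hD𝒰⟩ ⟨y, hyD, hyN, hyV, hyb⟩
    obtain ⟨⟨T, j⟩, rfl⟩ := hcomp D hD
    have hyT : {i | y ∈ V i} = T := hGH T ((hCP T j).2.2 (subset_closure hyD))
    refine ⟨(T, j), ⟨fun k hk => ?_, ?_⟩, rfl⟩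
    · rw [← hyT] at hk
      exact ⟨y, hk, hyN⟩
    · by_contra hj
      refine hD𝒰 u hu fun z hz => ?_
      have hiT : i ∈ T := hyT ▸ hyV
      have hzs : z ∈ (e i).source :=
        hVe i (hHV T i hiT (hGH T ((hCP T j).2.2 (subset_closure hz))))
      have hPj : P T j (C T j) := by
        rcases hC T j with h | h
        · exact absurd (h ▸ hz : z ∈ (∅ : Set M)) (notMem_empty z)
        · exact h.1
      have h1 := hPj.2.2.2 i hiT z hz y hyD
      have h2 : ((1 : ℝ) / 2) ^ j ≤ (1 / 2) ^ m :=
        pow_le_pow_of_le_one (by norm_num) (by norm_num) (not_lt.1 hj)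
      have h3 : dist (e i y) (e i x) < ε / 2 := hyb
      have h4 : e i z ∈ Metric.ball (e i x) ε := by
        rw [Metric.mem_ball]
        linarith [dist_triangle (e i z) (e i y) (e i x)]
      have h5 := (hball h4).2
      rwa [mem_preimage, (e i).left_inv hzs] at h5
  · intro D hD D' hD' hne
    obtain ⟨p, rfl⟩ := hcomp D hD
    obtain ⟨q, rfl⟩ := hcomp D' hD'
    exact (hdisj fun h => hne (by rw [h])).inter_eq
  · intro D hD
    obtain ⟨p, rfl⟩ := hcomp D hD
    rcases hC p.1 p.2 with h | h
    · obtain ⟨x, hx, hxp⟩ := hD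
      have : x ∈ c p := hxp ▸ mem_connectedComponentIn hx
      exact absurd (h ▸ this : x ∈ (∅ : Set M)) (notMem_empty x)
    · exact h.1.2.2.1
  · intro x hx hxc
    obtain ⟨p, hp⟩ := mem_iUnion.1 hxc
    exact ((hCP p.1 p.2).2.2 (subset_closure hp)).2 (subset_closure hx)

/-- Transport of balls from a model space `X` to a space `M` locally modeled on `X`. -/
theorem exists_ball_of_charts {n : Option ℕ} {M X Z : Type*} [TopologicalSpace M]
    [TopologicalSpace X] [TopologicalSpace Z]
    (hch : ∀ x : M, ∃ e : OpenPartialHomeomorph M X, x ∈ e.source)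
    (hX : ∀ U : Set X, IsOpen U → U.Nonempty → ∃ φ : Z → X, IsOpenEmbedding φ ∧ range φ ⊆ U)
    {W : Set Z} (hWo : IsOpen W) (hWc : IsConnected W) (hWk : IsCompact (closure W))
    (htame : ∀ ψ : Z → M, IsOpenEmbedding ψ → IsTameBall n (ψ '' closure W))
    {U : Set M} (hU : IsOpen U) (hne : U.Nonempty) :
    ∃ C B : Set M, IsOpen C ∧ IsPreconnected C ∧
      C.Nonempty ∧ C ⊆ B ∧ B ⊆ closure C ∧ IsCompact B ∧ B ⊆ U ∧ IsTameBall n B := by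
  obtain ⟨x, hx⟩ := hne
  obtain ⟨e, he⟩ := hch x
  have hopen : IsOpen (e.target ∩ e.symm ⁻¹' U) := e.symm.isOpen_inter_preimage hU
  obtain ⟨φ, hφ, hφU⟩ := hX _ hopen
    ⟨e x, e.map_source he, by simpa [e.left_inv he] using hx⟩
  have : Nonempty Z := ⟨hWc.nonempty.some⟩
  have hψ : IsOpenEmbedding (e.symm ∘ φ) := by
    refine ((hφ.toOpenPartialHomeomorph φ).trans e.symm).isOpenEmbedding ?_
    rw [OpenPartialHomeomorph.trans_source]
    simp only [IsOpenEmbedding.toOpenPartialHomeomorph_source, univ_inter]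
    exact eq_univ_of_forall fun z => (hφU (mem_range_self z)).1
  refine ⟨_, _, hψ.isOpenMap W hWo, hWc.isPreconnected.image _ hψ.continuous.continuousOn,
    hWc.nonempty.image _, image_mono subset_closure, image_closure_subset_closure_image
    hψ.continuous, hWk.image hψ.continuous, ?_, htame _ hψ⟩
  rintro _ ⟨z, -, rfl⟩
  exact (hφU (mem_range_self z)).2

theorem pairHomeo_of_isOpenEmbedding {M Z : Type*} [TopologicalSpace M] [TopologicalSpace Z]
    {ψ : Z → M} (hψ : IsOpenEmbedding ψ) (K : Set Z) :
    PairHomeo {x : ↥(range ψ) | (x : M) ∈ ψ '' K} K := by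
  refine ⟨hψ.toIsEmbedding.toHomeomorph.symm, ?_⟩
  rw [Homeomorph.image_symm]
  ext z
  exact hψ.injective.mem_set_image

theorem exists_isOpenEmbedding_real_unitInterval {U : Set unitInterval} (hU : IsOpen U)
    (hne : U.Nonempty) : ∃ f : ℝ → unitInterval, IsOpenEmbedding f ∧ range f ⊆ U := by
  have hd : Dense (Ioo (0 : unitInterval) 1) := by
    rw [dense_iff_closure_eq, closure_Ioo zero_ne_one]
    exact eq_univ_of_forall fun t => ⟨bot_le, le_top⟩
  obtain ⟨t, htU, ht⟩ := hd.inter_open_nonempty U hU hne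
  have hV : IsOpen (Ioo (0 : ℝ) 1 ∩ projIcc 0 1 zero_le_one ⁻¹' U) :=
    isOpen_Ioo.inter (hU.preimage continuous_projIcc)
  obtain ⟨ε, hε, hball⟩ := Metric.isOpen_iff.1 hV (t : ℝ)
    ⟨ht, by rwa [mem_preimage, projIcc_val]⟩
  have hg : IsOpenEmbedding (OpenPartialHomeomorph.univBall (t : ℝ) ε) :=
    OpenPartialHomeomorph.isOpenEmbedding _ (OpenPartialHomeomorph.univBall_source _ _)
  have hmem : ∀ x, OpenPartialHomeomorph.univBall (t : ℝ) ε x ∈ Metric.ball (t : ℝ) ε := by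
    intro x
    rw [← OpenPartialHomeomorph.univBall_target _ hε]
    exact OpenPartialHomeomorph.map_source _ (by simp)
  have hI : ∀ x, OpenPartialHomeomorph.univBall (t : ℝ) ε x ∈ unitInterval := fun x =>
    Ioo_subset_Icc_self (hball (hmem x)).1
  refine ⟨fun x => ⟨_, hI x⟩, ⟨hg.toIsEmbedding.codRestrict _ hI, ?_⟩, ?_⟩
  · convert hg.isOpen_range.preimage (continuous_subtype_val (p := (· ∈ unitInterval))) using 1
    ext s
    simp [Subtype.ext_iff]
  · rintro _ ⟨x, rfl⟩
    have := (hball (hmem x)).2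
    rwa [mem_preimage, projIcc_of_mem _ (hI x)] at this

theorem exists_isOpenEmbedding_finCube (k : ℕ) {U : Set (Fin k → unitInterval)} (hU : IsOpen U)
    (hne : U.Nonempty) : ∃ f : (Fin k → ℝ) → Fin k → unitInterval,
      IsOpenEmbedding f ∧ range f ⊆ U := by
  obtain ⟨x, hx⟩ := hne
  obtain ⟨u, hu, huU⟩ := isOpen_pi_iff'.1 hU x hx
  choose f hf hfu using fun i => exists_isOpenEmbedding_real_unitInterval (hu i).1 ⟨_, (hu i).2⟩
  refine ⟨Pi.map f, .piMap hf, ?_⟩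
  rintro _ ⟨y, rfl⟩
  exact huU fun i _ => hfu i (mem_range_self _)

theorem isOpen_setPi_Ioo_finite (k : ℕ) :
    IsOpen (univ.pi fun _ : Fin k => Ioo (0 : ℝ) 1) :=
  isOpen_set_pi finite_univ fun _ _ => isOpen_Ioo

theorem closure_setPi_Ioo (k : ℕ) :
    closure (univ.pi fun _ : Fin k => Ioo (0 : ℝ) 1) = stdCube k := by
  rw [closure_pi_set]
  ext f
  simp only [stdCube, mem_univ_pi, mem_ofPred_eq, closure_Ioo zero_ne_one]

theorem isConnected_setPi_Ioo (k : ℕ) :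
    IsConnected (univ.pi fun _ : Fin k => Ioo (0 : ℝ) 1) :=
  isConnected_univ_pi.2 fun _ => isConnected_Ioo zero_lt_one

theorem isCompact_stdCube (k : ℕ) : IsCompact (stdCube k) := by
  convert isCompact_univ_pi fun _ : Fin k => isCompact_Icc (a := (0 : ℝ)) (b := 1) using 1
  ext f
  simp only [stdCube, mem_univ_pi, mem_ofPred_eq]

/-- Elliptic coordinates: the half-strip `[0,1] × [0,∞)` is homeomorphic to the closed half-plane
`ℝ × [0,∞)`. -/
def ellipticHomeomorph : unitInterval × ↥(Ici (0 : ℝ)) ≃ₜ ℝ × ↥(Ici (0 : ℝ)) where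
  toFun z := ((2 * (z.1 : ℝ) - 1) * (1 + z.2),
    ⟨√(4 * z.1 * (1 - z.1) * (z.2 * (z.2 + 2))), Real.sqrt_nonneg _⟩)
  invFun w :=
    (projIcc 0 1 zero_le_one
      (1 / 2 + (√((w.1 + 1) ^ 2 + (w.2 : ℝ) ^ 2) - √((w.1 - 1) ^ 2 + (w.2 : ℝ) ^ 2)) / 4),
     ⟨max 0 ((√((w.1 + 1) ^ 2 + (w.2 : ℝ) ^ 2) + √((w.1 - 1) ^ 2 + (w.2 : ℝ) ^ 2)) / 2 - 1),
       mem_Ici.2 (le_max_left _ _)⟩)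
  left_inv := by
    rintro ⟨⟨s, hs0, hs1⟩, ⟨t, ht⟩⟩
    have ht : 0 ≤ t := ht
    have hnn : 0 ≤ 4 * s * (1 - s) * (t * (t + 2)) := by
      have := sub_nonneg.2 hs1
      positivity
    have hp : √(((2 * s - 1) * (1 + t) + 1) ^ 2 + √(4 * s * (1 - s) * (t * (t + 2))) ^ 2)
        = t + 2 * s := by
      rw [Real.sq_sqrt hnn, show ((2 * s - 1) * (1 + t) + 1) ^ 2 +
        4 * s * (1 - s) * (t * (t + 2)) = (t + 2 * s) ^ 2 by ring]
      exact Real.sqrt_sq (by positivity)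
    have hq : √(((2 * s - 1) * (1 + t) - 1) ^ 2 + √(4 * s * (1 - s) * (t * (t + 2))) ^ 2)
        = t + 2 * (1 - s) := by
      rw [Real.sq_sqrt hnn, show ((2 * s - 1) * (1 + t) - 1) ^ 2 +
        4 * s * (1 - s) * (t * (t + 2)) = (t + 2 * (1 - s)) ^ 2 by ring]
      exact Real.sqrt_sq (by linarith)
    refine Prod.ext (Subtype.ext ?_) (Subtype.ext ?_)
    · simp only [hp, hq]
      rw [projIcc_of_mem _ ⟨by linarith, by linarith⟩]
      simp only
      ring
    · simp only [hp, hq]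
      rw [max_eq_right (by linarith)]
      ring
  right_inv := by
    rintro ⟨u, ⟨v, hv⟩⟩
    have hv : 0 ≤ v := hv
    set p := √((u + 1) ^ 2 + v ^ 2) with hp
    set q := √((u - 1) ^ 2 + v ^ 2) with hq
    have hp2 : p ^ 2 = (u + 1) ^ 2 + v ^ 2 := Real.sq_sqrt (by positivity)
    have hq2 : q ^ 2 = (u - 1) ^ 2 + v ^ 2 := Real.sq_sqrt (by positivity)
    have hp0 : 0 ≤ p := Real.sqrt_nonneg _
    have hq0 : 0 ≤ q := Real.sqrt_nonneg _
    have hpu : |u + 1| ≤ p := Real.abs_le_sqrt (by nlinarith)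
    have hqu : |u - 1| ≤ q := Real.abs_le_sqrt (by nlinarith)
    have hpu' := abs_le.1 hpu
    have hqu' := abs_le.1 hqu
    have h1 : p ≤ q + 2 := abs_le_of_sq_le_sq' (by nlinarith) (by linarith) |>.2
    have h2 : q ≤ p + 2 := abs_le_of_sq_le_sq' (by nlinarith) (by linarith) |>.2
    refine Prod.ext ?_ (Subtype.ext ?_)
    · simp only [← hp, ← hq]
      rw [projIcc_of_mem _ ⟨by linarith, by linarith⟩, max_eq_right (by linarith)]
      simp only
      linear_combination (hp2 - hq2) / 4
    · simp only [← hp, ← hq]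
      rw [projIcc_of_mem _ ⟨by linarith, by linarith⟩, max_eq_right (by linarith)]
      simp only
      refine Eq.trans (congrArg Real.sqrt ?_) (Real.sqrt_sq hv)
      linear_combination (1 / 2 - (p ^ 2 - q ^ 2 + 4 * u) / 16) * hp2 +
        (1 / 2 + (p ^ 2 - q ^ 2 + 4 * u) / 16) * hq2
  continuous_toFun := by fun_prop
  continuous_invFun := by
    refine .prodMk (continuous_projIcc.comp (by fun_prop)) (.subtype_mk (by fun_prop) _)

/-- The homeomorphism `t ↦ t / (2 - t)` of `[0,2)` onto `[0,∞)`. -/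
def icoHomeomorphIci : ↥(Ico (0 : ℝ) 2) ≃ₜ ↥(Ici (0 : ℝ)) where
  toFun t := ⟨t / (2 - t), div_nonneg t.2.1 (sub_nonneg.2 t.2.2.le)⟩
  invFun v := ⟨2 * v / (1 + v), by
    have hv : 0 ≤ (v : ℝ) := v.2
    refine ⟨by positivity, ?_⟩
    rw [div_lt_iff₀ (by positivity)]
    linarith⟩
  left_inv := by
    rintro ⟨t, ht0, ht2⟩
    have : 2 - t ≠ 0 := by linarith
    refine Subtype.ext ?_
    simp only
    field_simp
    ring
  right_inv := by
    rintro ⟨v, hv⟩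
    have hv : 0 ≤ v := hv
    have : 1 + v ≠ 0 := by positivity
    refine Subtype.ext ?_
    simp only
    field_simp
    ring
  continuous_toFun := by
    refine .subtype_mk (.div (by fun_prop) (by fun_prop) fun t => ?_) _
    linarith [t.2.2]
  continuous_invFun := by
    refine .subtype_mk (.div (by fun_prop) (by fun_prop) fun v => ?_) _
    have hv : 0 ≤ (v : ℝ) := v.2
    positivity

theorem exists_isOpenEmbedding_prod_Ico {J : Set unitInterval} (hJ : IsOpen J)
    (hne : J.Nonempty) :
    ∃ g : unitInterval × ↥(Ico (0 : ℝ) 2) → unitInterval × ↥(Ico (0 : ℝ) 2),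
      IsOpenEmbedding g ∧ ∀ z, (g z).1 ∈ J := by
  obtain ⟨f, hf, hfJ⟩ := exists_isOpenEmbedding_real_unitInterval hJ hne
  refine ⟨Prod.map f icoHomeomorphIci.symm ∘ ellipticHomeomorph ∘ Prod.map id icoHomeomorphIci,
    (hf.prodMap icoHomeomorphIci.symm.isOpenEmbedding).comp
      (ellipticHomeomorph.isOpenEmbedding.comp
        (IsOpenEmbedding.id.prodMap icoHomeomorphIci.isOpenEmbedding)),
    fun z => hfJ (mem_range_self _)⟩

/-- An open self-embedding of `I^D × [0,2)` whose image has prescribed finitely many coordinates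
in prescribed open sets. -/
theorem exists_isOpenEmbedding_finset {D : Type*} [DecidableEq D] (F : Finset D)
    {J : D → Set unitInterval} (hJ : ∀ i ∈ F, IsOpen (J i)) (hne : ∀ i ∈ F, (J i).Nonempty) :
    ∃ ψ : (D → unitInterval) × ↥(Ico (0 : ℝ) 2) → (D → unitInterval) × ↥(Ico (0 : ℝ) 2),
      IsOpenEmbedding ψ ∧ ∀ z, ∀ i ∈ F, (ψ z).1 i ∈ J i := by
  induction F using Finset.induction_on with
  | empty => exact ⟨id, .id, by simp⟩
  | insert a F ha ih =>
    obtain ⟨ψ, hψ, hψJ⟩ := ih (fun i hi => hJ i (Finset.mem_insert_of_mem hi))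
      fun i hi => hne i (Finset.mem_insert_of_mem hi)
    obtain ⟨g, hg, hgJ⟩ := exists_isOpenEmbedding_prod_Ico (hJ a (Finset.mem_insert_self a F))
      (hne a (Finset.mem_insert_self a F))
    let h : (D → unitInterval) × ↥(Ico (0 : ℝ) 2) ≃ₜ
        ({j // j ≠ a} → unitInterval) × (unitInterval × ↥(Ico (0 : ℝ) 2)) :=
      (((Homeomorph.funSplitAt unitInterval a).trans (Homeomorph.prodComm _ _)).prodCongr
        (Homeomorph.refl _)).trans (Homeomorph.prodAssoc _ _ _)
    refine ⟨h.symm ∘ Prod.map id g ∘ h ∘ ψ, h.symm.isOpenEmbedding.comp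
      ((IsOpenEmbedding.id.prodMap hg).comp (h.isOpenEmbedding.comp hψ)), fun z i hi => ?_⟩
    by_cases hia : i = a
    · subst hia
      have hi (w) : (h.symm w).1 i = w.2.1 := by
        change (Homeomorph.funSplitAt unitInterval i).symm (w.2.1, w.1) i = _
        simp
      simp only [Function.comp_apply, hi]
      exact hgJ _
    · have hi' (w) : (h.symm w).1 i = w.1 ⟨i, hia⟩ := by
        change (Homeomorph.funSplitAt unitInterval a).symm (w.2.1, w.1) i = _
        simp [hia]
      simp only [Function.comp_apply, hi']
      exact hψJ z i ((Finset.mem_insert.1 hi).resolve_left hia)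

theorem exists_isOpenEmbedding_hilbertCube {U : Set (ℕ → unitInterval)} (hU : IsOpen U)
    (hne : U.Nonempty) : ∃ f : (ℕ → unitInterval) × ↥(Ico (0 : ℝ) 2) → ℕ → unitInterval,
      IsOpenEmbedding f ∧ range f ⊆ U := by
  obtain ⟨x, hx⟩ := hne
  obtain ⟨F, u, hu, huU⟩ := isOpen_pi_iff.1 hU x hx
  obtain ⟨m, hm⟩ := Infinite.exists_notMem_finset F
  obtain ⟨ψ, hψ, hψu⟩ := exists_isOpenEmbedding_finset (F.subtype (· ≠ m))
    (J := fun i => u i) (fun i hi => (hu i (Finset.mem_subtype.1 hi)).1)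
    (fun i hi => ⟨_, (hu i (Finset.mem_subtype.1 hi)).2⟩)
  have hIcc : ∀ t : ↥(Ico (0 : ℝ) 2), (t : ℝ) / 2 ∈ unitInterval := fun t =>
    ⟨div_nonneg t.2.1 zero_le_two, by linarith [t.2.2]⟩
  let c : ↥(Ico (0 : ℝ) 2) → unitInterval := fun t => ⟨t / 2, hIcc t⟩
  have hc : IsOpenEmbedding c := by
    refine ⟨IsEmbedding.codRestrict
      ((Homeomorph.mulRight₀ (2 : ℝ)⁻¹ (by norm_num)).isEmbedding.comp .subtypeVal) _ hIcc, ?_⟩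
    convert isOpen_Iio (a := (1 : unitInterval)) using 1
    ext s
    constructor
    · rintro ⟨t, rfl⟩
      change (t : ℝ) / 2 < 1
      linarith [t.2.2]
    · intro hs
      have hs : (s : ℝ) < 1 := hs
      exact ⟨⟨2 * s, by linarith [s.2.1], by linarith⟩, Subtype.ext (by simp [c])⟩
  have : Infinite {j : ℕ // j ≠ m} :=
    (Set.finite_singleton m).infinite_compl.to_subtype
  obtain ⟨ν⟩ : Nonempty (ℕ ≃ {j : ℕ // j ≠ m}) := nonempty_equiv_of_countable
  let r : (ℕ → unitInterval) ≃ₜ ({j : ℕ // j ≠ m} → unitInterval) :=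
    Homeomorph.piCongrLeft (Y := fun _ => unitInterval) ν
  refine ⟨(Homeomorph.funSplitAt unitInterval m).symm ∘ Prod.swap ∘ Prod.map id c ∘ ψ ∘
    Prod.map r id, (Homeomorph.isOpenEmbedding _).comp
      ((Homeomorph.prodComm _ _).isOpenEmbedding.comp
      ((IsOpenEmbedding.id.prodMap hc).comp (hψ.comp
        (r.isOpenEmbedding.prodMap .id)))), ?_⟩
  rintro _ ⟨z, rfl⟩
  refine huU fun i hi => ?_
  have him : i ≠ m := fun h => hm (h ▸ hi)
  have := hψu (Prod.map r id z) ⟨i, him⟩ (Finset.mem_subtype.2 hi)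
  simpa [him] using this

theorem val_image_lt :
    Subtype.val '' {t : ↥(Ico (0 : ℝ) 2) | (t : ℝ) < 1} = Ico (0 : ℝ) 1 := by
  ext s
  constructor
  · rintro ⟨t, ht, rfl⟩
    exact ⟨t.2.1, ht⟩
  · rintro ⟨h0, h1⟩
    exact ⟨⟨s, h0, by linarith⟩, h1, rfl⟩

theorem closure_hilbertCollar_interior :
    closure (univ ×ˢ {t : ↥(Ico (0 : ℝ) 2) | (t : ℝ) < 1}) = hilbertCollar := by
  rw [closure_prod_eq, closure_univ, IsInducing.subtypeVal.closure_eq_preimage_closure_image,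
    val_image_lt, closure_Ico zero_ne_one]
  ext ⟨x, t⟩
  have := t.2.1
  simp [hilbertCollar, this]

theorem isConnected_hilbertCollar_interior :
    IsConnected ((univ : Set (ℕ → unitInterval)) ×ˢ {t : ↥(Ico (0 : ℝ) 2) | (t : ℝ) < 1}) := by
  refine isConnected_univ.prod ⟨⟨⟨0, by simp⟩, by simp⟩, ?_⟩
  rw [← IsInducing.subtypeVal.isPreconnected_image, val_image_lt]
  exact isPreconnected_Ico

theorem isCompact_hilbertCollar : IsCompact hilbertCollar := by
  have h : hilbertCollar = univ ×ˢ {t : ↥(Ico (0 : ℝ) 2) | (t : ℝ) ≤ 1} := by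
    ext; simp [hilbertCollar]
  rw [h]
  refine isCompact_univ.prod (IsInducing.subtypeVal.isCompact_iff.2 ?_)
  convert isCompact_Icc (a := (0 : ℝ)) (b := 1) using 1
  ext s
  constructor
  · rintro ⟨t, ht, rfl⟩
    exact ⟨t.2.1, ht⟩
  · rintro ⟨h0, h1⟩
    exact ⟨⟨s, h0, by linarith⟩, h1, rfl⟩

theorem exists_chart_of_homeomorph {M X : Type*} [TopologicalSpace M] [TopologicalSpace X]
    {x : M} (h : ∃ O : Set M, IsOpen O ∧ x ∈ O ∧ ∃ U : Set X, IsOpen U ∧ Nonempty (↥O ≃ₜ ↥U)) :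
    ∃ e : OpenPartialHomeomorph M X, x ∈ e.source := by
  obtain ⟨O, hO, hx, U, hU, ⟨f⟩⟩ := h
  have hO' : Nonempty (⟨O, hO⟩ : TopologicalSpace.Opens M) := ⟨⟨x, hx⟩⟩
  have hU' : Nonempty (⟨U, hU⟩ : TopologicalSpace.Opens X) := ⟨f ⟨x, hx⟩⟩
  have g : (⟨O, hO⟩ : TopologicalSpace.Opens M) ≃ₜ (⟨U, hU⟩ : TopologicalSpace.Opens X) := f
  refine ⟨((TopologicalSpace.Opens.openPartialHomeomorphSubtypeCoe _ hO').symm.trans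
    g.toOpenPartialHomeomorph).trans
    (TopologicalSpace.Opens.openPartialHomeomorphSubtypeCoe _ hU'), ?_⟩
  simpa [OpenPartialHomeomorph.trans_source] using hx

/-- Theorem 1(1): every nowhere dense subset of an `I^n`-manifold lies in a spongy
subset. -/
theorem nowhereDense_subset_spongy (n : Option ℕ) (M : Type*) [TopologicalSpace M]
    (hM : IsManifoldModeledOn M (ModelCube n)) (A : Set M) (hA : IsNowhereDense A) :
    ∃ S : Set M, IsSpongy n S ∧ A ⊆ S := by
  obtain ⟨hpara, hloc⟩ := hM
  have hch := fun x => exists_chart_of_homeomorph (hloc x)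
  cases n with
  | some k =>
    change ∀ x : M, ∃ e : OpenPartialHomeomorph M (Fin k → unitInterval), x ∈ e.source at hch
    refine exists_isSpongy_of_charts (some k) hch (fun U hU hne => ?_) hA
    refine exists_ball_of_charts hch (fun U hU hne => exists_isOpenEmbedding_finCube k hU hne)
      (isOpen_setPi_Ioo_finite k) (isConnected_setPi_Ioo k)
      (closure_setPi_Ioo k ▸ isCompact_stdCube k) (fun ψ hψ => ?_) hU hne
    rw [closure_setPi_Ioo]
    exact ⟨range ψ, hψ.isOpen_range, image_subset_range _ _, pairHomeo_of_isOpenEmbedding hψ _⟩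
  | none =>
    change ∀ x : M, ∃ e : OpenPartialHomeomorph M (ℕ → unitInterval), x ∈ e.source at hch
    let _ : MetricSpace (ℕ → unitInterval) := TopologicalSpace.metrizableSpaceMetric _
    refine exists_isSpongy_of_charts none hch (fun U hU hne => ?_) hA
    have hW : IsOpen ((univ : Set (ℕ → unitInterval)) ×ˢ
        {t : ↥(Ico (0 : ℝ) 2) | (t : ℝ) < 1}) :=
      isOpen_univ.prod (isOpen_Iio.preimage continuous_subtype_val)
    refine exists_ball_of_charts hch (fun U hU hne => exists_isOpenEmbedding_hilbertCube hU hne)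
      hW
      isConnected_hilbertCollar_interior
      (closure_hilbertCollar_interior ▸ isCompact_hilbertCollar) (fun ψ hψ => ?_) hU hne
    rw [closure_hilbertCollar_interior]
    exact ⟨range ψ, hψ.isOpen_range, image_subset_range _ _, pairHomeo_of_isOpenEmbedding hψ _⟩

end
end

section
/- For any upper semicontinuous decomposition D of a metrizable space X, the decomposition space X/D is metrizable; moreover, if X is completely metrizable, then X/D is completely metrizable. -/
open Set Topology unitInterval

noncomputable section

open Filter Uniformity in
/-- A sharpened form of **Frink's metrization theorem**: besides inducing the topology, the
uniform structure has the property that for each `n` its small balls are contained in members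
of the cover `{V n x}`. -/
theorem exists_uniformSpace_of_frink {Y : Type*} [t : TopologicalSpace Y] (V : ℕ → Y → Set Y)
    (hanti : ∀ y, Antitone fun n => V n y)
    (hbasis : ∀ y, (𝓝 y).HasBasis (fun _ : ℕ => True) fun n => V n y)
    (hV : ∀ n y, ∃ m, ∀ z, (V m y ∩ V m z).Nonempty → V m z ⊆ V n y) :
    ∃ u : UniformSpace Y, u.toTopologicalSpace = t ∧ (𝓤[u]).IsCountablyGenerated ∧
      ∀ n, ∃ E ∈ 𝓤[u], ∀ s, ∃ x, {b | (s, b) ∈ E} ⊆ V n x := by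
  have hself : ∀ n y, y ∈ V n y := fun n y =>
    mem_of_mem_nhds ((hbasis y).mem_of_mem (i := n) trivial)
  have hV' : ∀ n y, ∃ m, n < m ∧ ∀ z, (V m y ∩ V m z).Nonempty → V m z ⊆ V n y := by
    intro n y
    obtain ⟨m, hm⟩ := hV n y
    refine ⟨max m (n + 1), by omega, fun z hz => ?_⟩
    have hle : m ≤ max m (n + 1) := le_max_left _ _
    exact (hanti z hle).trans (hm z (hz.mono (inter_subset_inter (hanti y hle) (hanti z hle))))
  choose M hlt hM using hV'
  let N : ℕ → Y → ℕ := fun k y => Nat.rec 0 (fun _ n => M n y) k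
  have hN_succ : ∀ k y, N (k + 1) y = M (N k y) y := fun _ _ => rfl
  have hN_mono : ∀ y, StrictMono fun k => N k y := fun y =>
    strictMono_nat_of_lt_succ fun k => hlt _ _
  have hN_le : ∀ k y, k ≤ N k y := fun k y => (hN_mono y).id_le k
  let W : ℕ → Y → Set Y := fun k y => V (N k y) y
  have hW_anti : ∀ y, Antitone fun k => W k y := fun y _ _ h => hanti y ((hN_mono y).monotone h)
  have hW_sub : ∀ k x y, N (k + 1) x ≤ N (k + 1) y → (W (k + 1) x ∩ W (k + 1) y).Nonempty →
      W (k + 1) y ⊆ W k x := by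
    intro k x y hle hne
    exact (hanti y hle).trans
      (hM _ x y (hne.mono (inter_subset_inter_right _ (hanti y hle))))
  let E : ℕ → Set (Y × Y) := fun k => {p | ∃ x, p.1 ∈ W k x ∧ p.2 ∈ W k x}
  have hE_anti : Antitone E := fun k l h p ⟨x, h₁, h₂⟩ => ⟨x, hW_anti x h h₁, hW_anti x h h₂⟩
  have hE_star : ∀ k s, ∃ x, {b | (s, b) ∈ E (k + 1)} ⊆ W k x := by
    intro k s
    obtain ⟨x, hx, hmin⟩ := exists_minimalFor_of_wellFoundedLT (fun x => s ∈ W (k + 1) x)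
      (N (k + 1)) ⟨s, hself _ s⟩
    refine ⟨x, fun b ⟨y, hsy, hby⟩ => ?_⟩
    have hxy : N (k + 1) x ≤ N (k + 1) y :=
      (le_total (N (k + 1) x) (N (k + 1) y)).elim id fun h => hmin hsy h
    exact hW_sub k x y hxy ⟨s, hx, hsy⟩ hby
  have hE_symm : ∀ k a b, (a, b) ∈ E k → (b, a) ∈ E k := fun k a b ⟨x, ha, hb⟩ => ⟨x, hb, ha⟩
  have hB : (⨅ k, 𝓟 (E k)).HasBasis (fun _ => True) E :=
    hasBasis_iInf_principal hE_anti.directed_ge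
  refine ⟨{ toTopologicalSpace := t
            uniformity := ⨅ k, 𝓟 (E k)
            symm := (hB.tendsto_iff hB).2 fun k _ => ⟨k, trivial, fun p hp => hE_symm k _ _ hp⟩
            comp := ?_
            nhds_eq_comap_uniformity := fun y => ?_ }, rfl, ?_, fun n => ?_⟩
  · refine hB.ge_iff.2 fun k _ => ?_
    refine mem_of_superset (mem_lift' (hB.mem_of_mem (i := k + 1) trivial)) ?_
    rintro ⟨a, b⟩ ⟨s, has, hsb⟩
    obtain ⟨x, hx⟩ := hE_star k s
    exact ⟨x, hx (hE_symm (k + 1) a s has), hx hsb⟩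
  · refine (hbasis y).ext (hB.comap _) (fun n _ => ?_) fun k _ => ?_
    · refine ⟨M n y, trivial, fun b ⟨x, hy, hb⟩ => ?_⟩
      have hx : W (M n y) x ⊆ V (M n y) x := hanti x (hN_le _ _)
      exact hM n y x ⟨y, hself _ _, hx hy⟩ (hx hb)
    · exact ⟨N k y, trivial, fun b hb => ⟨y, hself _ _, hb⟩⟩
  · exact hB.isCountablyGenerated
  · refine ⟨E (n + 1), hB.mem_of_mem (i := n + 1) trivial, fun s => ?_⟩
    obtain ⟨x, hx⟩ := hE_star n s
    exact ⟨x, hx.trans (hanti x (hN_le n x))⟩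

open Filter Metric Uniformity in
/-- A perfect image of a metric space is metrizable, by a complete metric if the domain is
complete. -/
theorem IsProperMap.exists_metricSpace {X Y : Type*} [MetricSpace X] [t : TopologicalSpace Y]
    [T1Space Y] {f : X → Y} (hf : IsProperMap f) (hsurj : Function.Surjective f) :
    ∃ m : MetricSpace Y, m.toUniformSpace.toTopologicalSpace = t ∧
      (CompleteSpace X → @CompleteSpace Y m.toUniformSpace) := by
  have hK : ∀ y, IsCompact (f ⁻¹' {y}) := fun y => hf.isCompact_preimage isCompact_singleton
  have hker : ∀ {U : Set X}, IsOpen U → IsOpen (kernImage f U) :=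
    isClosedMap_iff_kernImage.1 hf.isClosedMap
  let r : ℕ → ℝ := fun n => 1 / ((n : ℝ) + 1)
  have hr : ∀ n, 0 < r n := fun n => Nat.one_div_pos_of_nat
  have hr_anti : ∀ {m n}, m ≤ n → r n ≤ r m := fun h => Nat.one_div_le_one_div h
  let V : ℕ → Y → Set Y := fun n y => kernImage f (thickening (r n) (f ⁻¹' {y}))
  have hV_pre : ∀ n y, f ⁻¹' (V n y) ⊆ thickening (r n) (f ⁻¹' {y}) := fun n y =>
    subset_kernImage_iff.1 Subset.rfl
  have hbasis : ∀ y, (𝓝 y).HasBasis (fun _ : ℕ => True) fun n => V n y := by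
    refine fun y => ⟨fun O => ⟨fun hO => ?_, ?_⟩⟩
    · obtain ⟨O', hO'O, hO', hy⟩ := mem_nhds_iff.1 hO
      obtain ⟨δ, hδ, hsub⟩ := (hK y).exists_thickening_subset_open (hO'.preimage hf.continuous)
        (preimage_mono (singleton_subset_iff.2 hy))
      obtain ⟨n, hn⟩ := exists_nat_one_div_lt hδ
      refine ⟨n, trivial, fun w hw => hO'O ?_⟩
      obtain ⟨x, rfl⟩ := hsurj w
      exact hsub (thickening_mono hn.le _ (hV_pre n y hw))
    · rintro ⟨n, -, hn⟩
      exact mem_of_superset ((hker isOpen_thickening).mem_nhds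
        fun x hx => self_subset_thickening (hr n) _ hx) hn
  obtain ⟨u, rfl, hu, hsmall⟩ := exists_uniformSpace_of_frink V
    (fun y m n h w hw x hx => thickening_mono (hr_anti h) _ (hw hx)) hbasis (by
      intro n y
      have hδ : 0 < r n / 2 := half_pos (hr n)
      obtain ⟨ε, hε, hsub⟩ := (hK y).exists_thickening_subset_open
        ((hker (isOpen_thickening (δ := r n / 2) (E := f ⁻¹' {y}))).preimage hf.continuous)
        (fun x hx x' hx' => self_subset_thickening hδ _ (hx'.trans hx))
      obtain ⟨m, hm⟩ := exists_nat_one_div_lt (lt_min hδ (half_pos hε))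
      have hm₁ : r m < r n / 2 := hm.trans_le (min_le_left _ _)
      have hm₂ : r m < ε / 2 := hm.trans_le (min_le_right _ _)
      refine ⟨m, ?_⟩
      rintro z ⟨w, hwy, hwz⟩ v hv a rfl
      obtain ⟨x, rfl⟩ := hsurj w
      obtain ⟨x', rfl, hxx'⟩ := mem_thickening_iff.1 (hV_pre m z hwz)
      have hx' : x' ∈ thickening ε (f ⁻¹' {y}) :=
        thickening_mono (by linarith : r m + r m ≤ ε) _ (thickening_thickening_subset _ _ _
          (mem_thickening_iff.2 ⟨x, hV_pre m y hwy, by rwa [dist_comm]⟩))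
      exact thickening_mono (by linarith : r m + r n / 2 ≤ r n) _ (thickening_thickening_subset _ _ _
        (thickening_subset_of_subset _ (fun b hb => hsub hx' hb) (hV_pre m _ hv))))
  refine ⟨UniformSpace.metricSpace Y, rfl, fun _ => ⟨fun {F} hF => ?_⟩⟩
  have := hF.1
  have := NeBot.comap_of_surj hF.1 hsurj
  let G := Ultrafilter.of (comap f F)
  have hG : Tendsto f G F := tendsto_comap.mono_left (Ultrafilter.of_le _)
  have hGc : Cauchy (G : Filter X) := by
    refine Metric.cauchy_iff.2 ⟨G.neBot, fun ε hε => ?_⟩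
    obtain ⟨n, hn⟩ := exists_nat_one_div_lt (by positivity : 0 < ε / 4)
    obtain ⟨E, hE, hEV⟩ := hsmall n
    obtain ⟨S, hS, hSE⟩ := (_root_.cauchy_iff.1 hF).2 E hE
    obtain ⟨s, hs⟩ := Filter.nonempty_of_mem hS
    obtain ⟨y, hy⟩ := hEV s
    have hmem : thickening (r n) (f ⁻¹' {y}) ∈ G :=
      mem_of_superset (hG hS) fun a ha => hV_pre n y (hy (hSE (mk_mem_prod hs ha)))
    obtain ⟨c, -, hc, hcov⟩ := (hK y).finite_cover_balls (hr n)
    have hcover : (⋃ i ∈ c, ball i (r n + r n)) ∈ G := by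
      refine mem_of_superset hmem fun a ha => ?_
      obtain ⟨b, hb, hab⟩ := mem_thickening_iff.1 ha
      obtain ⟨i, hi, hbi⟩ := mem_iUnion₂.1 (hcov hb)
      exact mem_iUnion₂.2 ⟨i, hi, (dist_triangle _ _ _).trans_lt (add_lt_add hab hbi)⟩
    obtain ⟨i, -, hi⟩ := (Ultrafilter.finite_biUnion_mem_iff hc).1 hcover
    refine ⟨_, hi, fun a ha b hb => ?_⟩
    have hn' : r n < ε / 4 := hn
    have := dist_triangle_right a b i
    rw [mem_ball] at ha hb
    linarith
  obtain ⟨a, ha⟩ := CompleteSpace.complete hGc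
  refine ⟨f a, le_nhds_of_cauchy_adhp hF ?_⟩
  exact ClusterPt.mono ((hf.continuous.tendsto a).mono_left ha).mapClusterPt hG

namespace Decomposition

variable {X : Type*} [TopologicalSpace X] (D : Decomposition X)

theorem mem_q (x : X) : x ∈ (D.q x).1 := (D.covers x).choose_spec.2

variable {D} in
theorem q_eq_iff {x : X} {A : D.Space} : D.q x = A ↔ x ∈ A.1 := by
  refine ⟨fun h => h ▸ D.mem_q x, fun h => Subtype.ext ?_⟩
  by_contra hne
  exact (D.disjoint' _ (D.q x).2 _ A.2 hne).le_bot ⟨D.mem_q x, h⟩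

theorem q_surjective : Function.Surjective D.q := fun A =>
  (D.nonempty' _ A.2).imp fun _ => q_eq_iff.2

theorem preimage_q_singleton (A : D.Space) : D.q ⁻¹' {A} = A.1 := ext fun _ => q_eq_iff

theorem isQuotientMap_q : IsQuotientMap D.q := ⟨⟨rfl⟩, D.q_surjective⟩

theorem t1Space [T2Space X] : T1Space D.Space where
  t1 A := by
    rw [← D.isQuotientMap_q.isClosed_preimage, preimage_q_singleton]
    exact (D.isCompact' _ A.2).isClosed

variable {D} in
theorem IsUSC.isProperMap_q (hD : D.IsUSC) : IsProperMap D.q := by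
  refine isProperMap_iff_isClosedMap_and_compact_fibers.2
    ⟨D.isQuotientMap_q.continuous, fun F hF => ?_, fun A => ?_⟩
  · rw [← D.isQuotientMap_q.isClosed_preimage]
    convert hD F hF using 1
    ext x
    constructor
    · rintro ⟨y, hy, hyx⟩
      exact ⟨_, ⟨(D.q x).2, y, q_eq_iff.1 hyx, hy⟩, D.mem_q x⟩
    · rintro ⟨A, ⟨hA, y, hyA, hy⟩, hx⟩
      exact ⟨y, hy, (q_eq_iff (A := ⟨A, hA⟩).2 hyA).trans (q_eq_iff.2 hx).symm⟩
  · rw [preimage_q_singleton]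
    exact D.isCompact' _ A.2

end Decomposition

/-- Lemma: the decomposition space of an upper semicontinuous decomposition of a
(completely) metrizable space is (completely) metrizable. -/
theorem usc_decomposition_space_metrizable (X : Type*) [TopologicalSpace X]
    (D : Decomposition X) (hD : D.IsUSC) :
    (TopologicalSpace.MetrizableSpace X → TopologicalSpace.MetrizableSpace D.Space) ∧
    (CompletelyMetrizable X → CompletelyMetrizable D.Space) := by
  have key : ∀ m : MetricSpace X, m.toUniformSpace.toTopologicalSpace = ‹TopologicalSpace X› →
      ∃ m' : MetricSpace D.Space,
        m'.toUniformSpace.toTopologicalSpace = (inferInstance : TopologicalSpace D.Space) ∧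
        (@CompleteSpace X m.toUniformSpace → @CompleteSpace D.Space m'.toUniformSpace) := by
    rintro m rfl
    have := D.t1Space
    exact hD.isProperMap_q.exists_metricSpace D.q_surjective
  constructor
  · intro _
    obtain ⟨m', hm', -⟩ := key (TopologicalSpace.metrizableSpaceMetric X) rfl
    exact hm'.subst (motive := fun t => @TopologicalSpace.MetrizableSpace D.Space t) inferInstance
  · rintro ⟨m, hm, hc⟩
    obtain ⟨m', hm', hc'⟩ := key m hm
    exact ⟨m', hm', hc' hc⟩

end
end

section
/- Let K be a tame family of compact subsets of a completely metrizable space X such that each set K ∈ K contains more than one point. Then for every open set U ⊆ X there is a K-tame decomposition D of X such that the union ⋃D° of the non-degenerate elements of D is a dense subset of U. -/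
open Set Topology unitInterval

noncomputable section

/-! ### Gluing homeomorphisms with disjoint supports -/

/-- A bijection that is the identity off `S` preserves `S`. -/
theorem Homeomorph.mem_support_iff {X : Type*} [TopologicalSpace X] (h : X ≃ₜ X) {S : Set X}
    (hS : ∀ x ∉ S, h x = x) (x : X) : h x ∈ S ↔ x ∈ S := by
  constructor
  · intro hx
    by_contra hn
    rw [hS x hn] at hx
    exact hn hx
  · intro hx
    by_contra hn
    have := h.injective (hS _ hn)
    rw [this] at hn
    exact hn hx

/-- The inverse of a homeomorphism supported in `S` is supported in `S`. -/
theorem Homeomorph.symm_eq_self_of_notMem {X : Type*} [TopologicalSpace X] (h : X ≃ₜ X)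
    {S : Set X} (hS : ∀ x ∉ S, h x = x) : ∀ x ∉ S, h.symm x = x := by
  intro x hx
  rw [Homeomorph.symm_apply_eq, hS x hx]

open Classical in
/-- The map acting as `k i` on the set `S i` and as the identity off all these sets. -/
def glueMap {X ι : Type*} [TopologicalSpace X] (S : ι → Set X) (k : ι → X ≃ₜ X) (x : X) : X :=
  if hx : ∃ i, x ∈ S i then k hx.choose x else x

section Glue

variable {X ι : Type*} [TopologicalSpace X] {S : ι → Set X} {k : ι → X ≃ₜ X}

theorem glueMap_of_mem (hd : ∀ i j x, x ∈ S i → x ∈ S j → i = j) {i : ι} {x : X}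
    (hx : x ∈ S i) : glueMap S k x = k i x := by
  have h : ∃ i, x ∈ S i := ⟨i, hx⟩
  rw [glueMap, dif_pos h, hd _ _ x h.choose_spec hx]

theorem glueMap_of_notMem {x : X} (hx : ∀ i, x ∉ S i) : glueMap S k x = x := by
  rw [glueMap, dif_neg]
  rintro ⟨i, hi⟩
  exact hx i hi

theorem glueMap_mem_iff (hd : ∀ i j x, x ∈ S i → x ∈ S j → i = j)
    (hk : ∀ i, ∀ x ∉ S i, k i x = x) (i : ι) (x : X) : glueMap S k x ∈ S i ↔ x ∈ S i := by
  by_cases h : ∃ j, x ∈ S j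
  · obtain ⟨j, hj⟩ := h
    rw [glueMap_of_mem hd hj]
    have hj' := ((k j).mem_support_iff (hk j) x).2 hj
    constructor
    · intro hi
      exact hd _ _ _ hj' hi ▸ hj
    · intro hi
      exact hd _ _ _ hj hi ▸ hj'
  · push Not at h
    rw [glueMap_of_notMem h]

theorem glueMap_symm_glueMap (hd : ∀ i j x, x ∈ S i → x ∈ S j → i = j)
    (hk : ∀ i, ∀ x ∉ S i, k i x = x) (x : X) :
    glueMap S (fun i => (k i).symm) (glueMap S k x) = x := by
  by_cases h : ∃ j, x ∈ S j
  · obtain ⟨j, hj⟩ := h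
    rw [glueMap_of_mem hd ((glueMap_mem_iff hd hk j x).2 hj), glueMap_of_mem hd hj]
    simp
  · push Not at h
    rw [glueMap_of_notMem h, glueMap_of_notMem h]

theorem glueMap_glueMap_symm (hd : ∀ i j x, x ∈ S i → x ∈ S j → i = j)
    (hk : ∀ i, ∀ x ∉ S i, k i x = x) (x : X) :
    glueMap S k (glueMap S (fun i => (k i).symm) x) = x := by
  have := glueMap_symm_glueMap (k := fun i => (k i).symm) hd
    (fun i => (k i).symm_eq_self_of_notMem (hk i)) x
  simpa using this

theorem continuousAt_glueMap (hd : ∀ i j x, x ∈ S i → x ∈ S j → i = j)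
    (hk : ∀ i, ∀ x ∉ S i, k i x = x) {x : X}
    (hx : ∃ N ∈ 𝓝 x, ∀ i j, (N ∩ S i).Nonempty → (N ∩ S j).Nonempty → i = j) :
    ContinuousAt (glueMap S k) x := by
  obtain ⟨N, hN, hu⟩ := hx
  by_cases h : ∃ i, (N ∩ S i).Nonempty
  · obtain ⟨i, hi⟩ := h
    refine (k i).continuous.continuousAt.congr ?_
    filter_upwards [hN] with y hy
    by_cases hyi : y ∈ S i
    · rw [glueMap_of_mem hd hyi]
    · rw [glueMap_of_notMem, hk i y hyi]
      intro j hj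
      exact hyi (hu j i ⟨y, hy, hj⟩ hi ▸ hj)
  · push Not at h
    refine continuousAt_id.congr ?_
    filter_upwards [hN] with y hy
    rw [glueMap_of_notMem]
    · rfl
    · intro j hj
      exact (Set.eq_empty_iff_forall_notMem.1 (h j)) y ⟨hy, hj⟩

/-- Homeomorphisms with disjoint supports, forming a discrete family in `W`, glue to a
homeomorphism of `W`. -/
theorem exists_homeomorph_glue {W : Set X} (hd : ∀ i j x, x ∈ S i → x ∈ S j → i = j)
    (hk : ∀ i, ∀ x ∉ S i, k i x = x) (hSW : ∀ i, S i ⊆ W)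
    (hW : ∀ x ∈ W, ∃ N ∈ 𝓝 x, ∀ i j, (N ∩ S i).Nonempty → (N ∩ S j).Nonempty → i = j) :
    ∃ h : ↥W ≃ₜ ↥W, (∀ i, ∀ x : ↥W, (x : X) ∈ S i → (h x : X) = k i x) ∧
      ∀ x : ↥W, (∀ i, (x : X) ∉ S i) → (h x : X) = x := by
  have hk' : ∀ i, ∀ x ∉ S i, (k i).symm x = x :=
    fun i => (k i).symm_eq_self_of_notMem (hk i)
  have hmap : ∀ k : ι → X ≃ₜ X, (∀ i, ∀ x ∉ S i, k i x = x) → ∀ x ∈ W, glueMap S k x ∈ W := by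
    intro k hk x hx
    by_cases h : ∃ i, x ∈ S i
    · obtain ⟨i, hi⟩ := h
      exact hSW i ((glueMap_mem_iff hd hk i x).2 hi)
    · push Not at h
      rwa [glueMap_of_notMem h]
  refine ⟨{ toFun := fun x => ⟨glueMap S k x, hmap k hk x x.2⟩
            invFun := fun x => ⟨glueMap S (fun i => (k i).symm) x, hmap _ hk' x x.2⟩
            left_inv := fun x => Subtype.ext (glueMap_symm_glueMap hd hk x)
            right_inv := fun x => Subtype.ext (glueMap_glueMap_symm hd hk x)
            continuous_toFun := ?_
            continuous_invFun := ?_ }, ?_, ?_⟩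
  · refine Continuous.subtype_mk (continuous_iff_continuousAt.2 fun x => ?_) _
    exact (continuousAt_glueMap hd hk (hW x x.2)).comp continuous_subtype_val.continuousAt
  · refine Continuous.subtype_mk (continuous_iff_continuousAt.2 fun x => ?_) _
    exact (continuousAt_glueMap hd hk' (hW x x.2)).comp continuous_subtype_val.continuousAt
  · intro i x hx
    exact glueMap_of_mem hd hx
  · intro x hx
    exact glueMap_of_notMem hx

end Glue

/-! ### Decompositions generated by disjoint families -/

/-- Any two points of `A` are at distance less than `r`. -/
def SmallSet {X : Type*} [MetricSpace X] (r : ℝ) (A : Set X) : Prop :=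
  ∀ x ∈ A, ∀ y ∈ A, dist x y < r

theorem smallSet_singleton {X : Type*} [MetricSpace X] {r : ℝ} (hr : 0 < r) (x : X) :
    SmallSet r {x} := by
  rintro y rfl z rfl
  simpa using hr

theorem SmallSet.mono {X : Type*} [MetricSpace X] {r s : ℝ} {A : Set X} (h : SmallSet r A)
    (hrs : r ≤ s) : SmallSet s A :=
  fun x hx y hy => (h x hx y hy).trans_le hrs

theorem SmallSet.subset_ball {X : Type*} [MetricSpace X] {r s : ℝ} {A : Set X}
    (h : SmallSet r A) {x c : X} (hx : x ∈ A) (hc : dist x c < s) :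
    A ⊆ Metric.ball c (r + s) := by
  intro y hy
  have h1 := h y hy x hx
  have h2 := dist_triangle y x c
  simp only [Metric.mem_ball]
  linarith

/-- The decomposition whose pieces are the members of a disjoint family of nonempty compact
sets and the singletons outside their union. -/
def Decomposition.ofFamily {X : Type*} [TopologicalSpace X] (P : Set (Set X))
    (hne : ∀ A ∈ P, A.Nonempty) (hc : ∀ A ∈ P, IsCompact A)
    (hd : ∀ A ∈ P, ∀ B ∈ P, A ≠ B → Disjoint A B) : Decomposition X where
  pieces := P ∪ {A | ∃ x ∉ ⋃₀ P, A = {x}}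
  nonempty' := by
    rintro A (hA | ⟨x, -, rfl⟩)
    · exact hne A hA
    · exact singleton_nonempty x
  isCompact' := by
    rintro A (hA | ⟨x, -, rfl⟩)
    · exact hc A hA
    · exact isCompact_singleton
  disjoint' := by
    rintro A (hA | ⟨x, hx, rfl⟩) B (hB | ⟨y, hy, rfl⟩) hAB
    · exact hd A hA B hB hAB
    · exact disjoint_singleton_right.2 fun h => hy ⟨A, hA, h⟩
    · exact disjoint_singleton_left.2 fun h => hx ⟨B, hB, h⟩
    · exact disjoint_singleton.2 fun h => hAB (by rw [h])
  covers := by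
    intro x
    by_cases hx : x ∈ ⋃₀ P
    · obtain ⟨A, hA, hxA⟩ := hx
      exact ⟨A, Or.inl hA, hxA⟩
    · exact ⟨{x}, Or.inr ⟨x, hx, rfl⟩, rfl⟩

/-- Distinct members of `P` of size at least `ε` are uniformly separated, for every `ε > 0`. -/
def SeparatedLarge {X : Type*} [MetricSpace X] (P : Set (Set X)) : Prop :=
  ∀ ε > 0, ∃ δ > 0, ∀ A ∈ P, ∀ B ∈ P, ¬ SmallSet ε A → ¬ SmallSet ε B → A ≠ B →
    ∀ a ∈ A, ∀ b ∈ B, δ ≤ dist a b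

/-- Every member of `P` can be made small by a homeomorphism with support near that member
which keeps the other members of `P` small. -/
def ShrinkableFamily {X : Type*} [MetricSpace X] (P : Set (Set X)) : Prop :=
  ∀ A ∈ P, ∀ ε > 0, ∃ h : X ≃ₜ X, ∃ δ > 0, δ ≤ ε ∧ (∀ x ∉ Metric.thickening δ A, h x = x) ∧
    SmallSet ε (h '' A) ∧
    ∀ B ∈ P, B ≠ A → (B ∩ Metric.thickening δ A).Nonempty → SmallSet ε B ∧ SmallSet ε (h '' B)

/-- The members of `P` contained in no member of an open cover form a discrete family. -/
theorem SeparatedLarge.exists_ball {X : Type*} [MetricSpace X] {P : Set (Set X)}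
    (hP : SeparatedLarge P) {𝒱 : Set (Set X)} {v : Set X} (hv : v ∈ 𝒱) (hvo : IsOpen v)
    {x : X} (hx : x ∈ v) :
    ∃ ρ > 0, ∀ A ∈ P, (∀ u ∈ 𝒱, ¬ A ⊆ u) → ∀ B ∈ P, (∀ u ∈ 𝒱, ¬ B ⊆ u) →
      (Metric.ball x ρ ∩ A).Nonempty → (Metric.ball x ρ ∩ B).Nonempty → A = B := by
  obtain ⟨ε, hε, hb⟩ := Metric.isOpen_iff.1 hvo x hx
  obtain ⟨δ, hδ, hsep⟩ := hP (ε / 2) (half_pos hε)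
  have key : ∀ A : Set X, (∀ u ∈ 𝒱, ¬ A ⊆ u) →
      (Metric.ball x (min (ε / 2) (δ / 2)) ∩ A).Nonempty → ¬ SmallSet (ε / 2) A := by
    rintro A hA ⟨a, ha, haA⟩ hs
    refine hA v hv (Subset.trans ?_ hb)
    have := hs.subset_ball haA (c := x) (s := ε / 2)
      (lt_of_lt_of_le ha (min_le_left _ _))
    simpa using this
  refine ⟨min (ε / 2) (δ / 2), lt_min (half_pos hε) (half_pos hδ), ?_⟩
  intro A hA hAu B hB hBu hxA hxB
  by_contra hne
  obtain ⟨a, ha, haA⟩ := id hxA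
  obtain ⟨b, hb, hbB⟩ := id hxB
  have h1 := hsep A hA B hB (key A hAu hxA) (key B hBu hxB) hne a haA b hbB
  have h2 : dist a x < δ / 2 := lt_of_lt_of_le ha (min_le_right _ _)
  have h3 : dist b x < δ / 2 := lt_of_lt_of_le hb (min_le_right _ _)
  have h4 := dist_triangle_right a b x
  linarith

theorem Decomposition.vanishing_ofFamily {X : Type*} [MetricSpace X] {P : Set (Set X)}
    {hne : ∀ A ∈ P, A.Nonempty} {hc : ∀ A ∈ P, IsCompact A}
    {hd : ∀ A ∈ P, ∀ B ∈ P, A ≠ B → Disjoint A B} (hP : SeparatedLarge P) :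
    (Decomposition.ofFamily P hne hc hd).Vanishing := by
  intro 𝒰 h𝒰 hcov x
  have mem : ∀ A ∈ (Decomposition.ofFamily P hne hc hd).pieces, (∀ u ∈ 𝒰, ¬ A ⊆ u) → A ∈ P := by
    rintro A (hA | ⟨y, -, rfl⟩) hu
    · exact hA
    · obtain ⟨u, huU, hyu⟩ : y ∈ ⋃₀ 𝒰 := hcov ▸ mem_univ y
      exact absurd (singleton_subset_iff.2 hyu) (hu u huU)
  obtain ⟨u, huU, hxu⟩ : x ∈ ⋃₀ 𝒰 := hcov ▸ mem_univ x
  obtain ⟨ρ, hρ, h⟩ := hP.exists_ball huU (h𝒰 u huU) hxu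
  exact ⟨Metric.ball x ρ, Metric.ball_mem_nhds x hρ,
    fun A hA hAu B hB hBu => h A (mem A hA hAu) hAu B (mem B hB hBu) hBu⟩

theorem Decomposition.stronglyShrinkable_ofFamily {X : Type*} [MetricSpace X]
    {P : Set (Set X)} {hne : ∀ A ∈ P, A.Nonempty} {hc : ∀ A ∈ P, IsCompact A}
    {hd : ∀ A ∈ P, ∀ B ∈ P, A ≠ B → Disjoint A B} (hP : SeparatedLarge P)
    (hS : ShrinkableFamily P) :
    (Decomposition.ofFamily P hne hc hd).StronglyShrinkable := by
  intro W hW _ 𝒰 h𝒰 hcU 𝒱 h𝒱 hcV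
  let ι := {A : Set X // A ∈ P ∧ A ⊆ W ∧ ∀ v ∈ 𝒱, ¬ A ⊆ v}
  -- the large pieces form a discrete family in `W`
  have hball : ∀ x ∈ W, ∃ ρ > 0, ∀ A B : ι, (Metric.ball x ρ ∩ (A : Set X)).Nonempty →
      (Metric.ball x ρ ∩ (B : Set X)).Nonempty → A = B := by
    intro x hx
    obtain ⟨v, hv, hxv⟩ := hcV hx
    obtain ⟨ρ, hρ, h⟩ := hP.exists_ball hv (h𝒱 v hv).1 hxv
    exact ⟨ρ, hρ, fun A B hA hB =>
      Subtype.ext (h A A.2.1 A.2.2.2 B B.2.1 B.2.2.2 hA hB)⟩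
  have hsep : ∀ A : ι, ∃ r > 0, ∀ B : ι, B ≠ A → ∀ a ∈ (A : Set X), ∀ b ∈ (B : Set X),
      r ≤ dist a b := by
    intro A
    have hex : ∀ x : X, ∃ G : Set X, IsOpen G ∧ (x ∈ W → x ∈ G) ∧
        ∀ B C : ι, (G ∩ (B : Set X)).Nonempty → (G ∩ (C : Set X)).Nonempty → B = C := by
      intro x
      by_cases hx : x ∈ W
      · obtain ⟨ρ, hρ, h⟩ := hball x hx
        exact ⟨Metric.ball x ρ, Metric.isOpen_ball, fun _ => Metric.mem_ball_self hρ, h⟩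
      · refine ⟨∅, isOpen_empty, fun h => absurd h hx, ?_⟩
        rintro B C ⟨y, hy, -⟩
        exact absurd hy (notMem_empty y)
    choose G hGo hxG hG using hex
    obtain ⟨r, hr, h⟩ := lebesgue_number_lemma_of_metric (hc A A.2.1) (c := G) hGo
      (fun a ha => mem_iUnion.2 ⟨a, hxG a (A.2.2.1 ha)⟩)
    refine ⟨r, hr, fun B hBA a ha b hb => ?_⟩
    by_contra hlt
    push Not at hlt
    obtain ⟨i, hi⟩ := h a ha
    exact hBA (hG i B A ⟨b, hi (by rwa [Metric.mem_ball']), hb⟩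
      ⟨a, hi (Metric.mem_ball_self hr), ha⟩)
  have hchoice : ∀ A : ι, ∃ ε > 0, (∃ u ∈ 𝒰, Metric.thickening ε (A : Set X) ⊆ u) ∧
      (∀ a ∈ (A : Set X), ∃ v ∈ 𝒱, Metric.ball a (2 * ε) ⊆ v) ∧
      ∀ B : ι, B ≠ A → ∀ a ∈ (A : Set X), ∀ b ∈ (B : Set X), 4 * ε ≤ dist a b := by
    intro A
    obtain ⟨a, ha⟩ := hne A A.2.1
    obtain ⟨u, hu, hau⟩ := hcU (A.2.2.1 ha)
    have hAu : (A : Set X) ⊆ u := (h𝒰 u hu).2.2 A (Or.inl A.2.1) A.2.2.1 ⟨a, ha, hau⟩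
    obtain ⟨ε₁, hε₁, h₁⟩ := (hc A A.2.1).exists_thickening_subset_open (h𝒰 u hu).1 hAu
    obtain ⟨ε₂, hε₂, h₂⟩ := lebesgue_number_lemma_of_metric_sUnion (hc A A.2.1)
      (fun v hv => (h𝒱 v hv).1) (A.2.2.1.trans hcV)
    obtain ⟨ε₃, hε₃, h₃⟩ := hsep A
    refine ⟨min ε₁ (min (ε₂ / 2) (ε₃ / 4)), by positivity, ⟨u, hu, ?_⟩, ?_, ?_⟩
    · exact (Metric.thickening_mono (min_le_left _ _) _).trans h₁
    · intro a ha
      obtain ⟨v, hv, hav⟩ := h₂ a ha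
      refine ⟨v, hv, (Metric.ball_subset_ball ?_).trans hav⟩
      have := (min_le_right ε₁ (min (ε₂ / 2) (ε₃ / 4))).trans (min_le_left _ _)
      linarith
    · intro B hB a ha b hb
      have := (min_le_right ε₁ (min (ε₂ / 2) (ε₃ / 4))).trans (min_le_right _ _)
      linarith [h₃ B hB a ha b hb]
  choose ε hε hεU hεV hεsep using hchoice
  have hS' : ∀ A : ι, _ := fun A : ι => hS A A.2.1 (ε A) (hε A)
  choose k δ hδ hδε hk hkA hkB using hS'
  have hdisj : ∀ (A B : ι) (x : X), x ∈ Metric.thickening (2 * ε A) (A : Set X) →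
      x ∈ Metric.thickening (δ B) (B : Set X) → A = B := by
    intro A B x hxA hxB
    by_contra hAB
    obtain ⟨a, ha, hxa⟩ := Metric.mem_thickening_iff.1 hxA
    obtain ⟨b, hb, hxb⟩ := Metric.mem_thickening_iff.1 hxB
    have h1 := hεsep A B (Ne.symm hAB) a ha b hb
    have h2 := hεsep B A hAB b hb a ha
    rw [dist_comm b a] at h2
    have h3 := dist_triangle_left a b x
    have h4 := hδε B
    have h5 := hε A
    have h6 := hε B
    linarith
  have hle : ∀ A : ι, δ A ≤ 2 * ε A := fun A => by linarith [hδε A, hε A]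
  have hd' : ∀ (A B : ι) (x : X), x ∈ Metric.thickening (δ A) (A : Set X) →
      x ∈ Metric.thickening (δ B) (B : Set X) → A = B :=
    fun A B x hA hB => hdisj A B x (Metric.thickening_mono (hle A) _ hA) hB
  have hSu : ∀ A : ι, ∃ u ∈ 𝒰, Metric.thickening (δ A) (A : Set X) ⊆ u := by
    intro A
    obtain ⟨u, hu, h⟩ := hεU A
    exact ⟨u, hu, (Metric.thickening_mono (hδε A) _).trans h⟩
  have hSW : ∀ A : ι, Metric.thickening (δ A) (A : Set X) ⊆ W := by
    intro A
    obtain ⟨u, hu, h⟩ := hSu A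
    exact h.trans (h𝒰 u hu).2.1
  have hlf : ∀ x ∈ W, ∃ N ∈ 𝓝 x, ∀ A B : ι,
      (N ∩ Metric.thickening (δ A) (A : Set X)).Nonempty →
      (N ∩ Metric.thickening (δ B) (B : Set X)).Nonempty → A = B := by
    intro x hx
    by_cases hxA : ∃ A : ι, x ∈ Metric.thickening (2 * ε A) (A : Set X)
    · obtain ⟨A, hA⟩ := hxA
      refine ⟨_, Metric.isOpen_thickening.mem_nhds hA, ?_⟩
      rintro B C ⟨y, hy, hyB⟩ ⟨z, hz, hzC⟩
      rw [← hdisj A B y hy hyB, hdisj A C z hz hzC]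
    · push Not at hxA
      have hfar : ∀ A : ι, ∀ a ∈ (A : Set X), 2 * ε A ≤ dist x a := by
        intro A a ha
        by_contra h
        push Not at h
        exact hxA A (Metric.mem_thickening_iff.2 ⟨a, ha, h⟩)
      obtain ⟨ρ, hρ, h⟩ := hball x hx
      -- a support meeting a small ball around `x` comes from a large piece near `x`
      have hnear : ∀ A : ι, (Metric.ball x (ρ / 2) ∩
          Metric.thickening (δ A) (A : Set X)).Nonempty →
          (Metric.ball x ρ ∩ (A : Set X)).Nonempty := by
        rintro A ⟨y, hy, hyA⟩
        obtain ⟨a, ha, hya⟩ := Metric.mem_thickening_iff.1 hyA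
        refine ⟨a, ?_, ha⟩
        have h1 := hfar A a ha
        have h2 := dist_triangle x y a
        have h3 := hδε A
        rw [Metric.mem_ball'] at hy ⊢
        linarith
      exact ⟨_, Metric.ball_mem_nhds x (half_pos hρ), fun A B hA hB =>
        h A B (hnear A hA) (hnear B hB)⟩
  obtain ⟨h, hh, hid⟩ := exists_homeomorph_glue hd' hk hSW hlf
  refine ⟨h, ?_, ?_⟩
  · intro x hx
    by_cases hxA : ∃ A : ι, (x : X) ∈ Metric.thickening (δ A) (A : Set X)
    · obtain ⟨A, hA⟩ := hxA
      obtain ⟨u, hu, hAu⟩ := hSu A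
      refine ⟨u, hu, hAu ?_, hAu hA⟩
      simp only [hh A x hA]
      exact ((k A).mem_support_iff (hk A) x).2 hA
    · push Not at hxA
      exact absurd (hid x hxA) hx
  · intro B hB hBW
    -- sets moved only by the homeomorphism shrinking `A` have small image near `A`
    have hsmall : ∀ A : ι, B ⊆ Metric.thickening (2 * ε A) (A : Set X) →
        (B ∩ Metric.thickening (δ A) (A : Set X)).Nonempty → SmallSet (ε A) (k A '' B) →
        ∃ v ∈ 𝒱, (fun x : ↥W => (x : X)) '' (⇑h '' {x : ↥W | (x : X) ∈ B}) ⊆ v := by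
      rintro A hBA ⟨y, hyB, hyA⟩ hs
      obtain ⟨a, ha, hya⟩ := Metric.mem_thickening_iff.1
        (((k A).mem_support_iff (hk A) y).2 hyA)
      obtain ⟨v, hv, hav⟩ := hεV A a ha
      refine ⟨v, hv, ?_⟩
      have hsub := hs.subset_ball (mem_image_of_mem _ hyB) (hya.trans_le (hδε A))
      rintro _ ⟨_, ⟨x, hx, rfl⟩, rfl⟩
      refine hav ?_
      rw [two_mul]
      apply hsub
      refine ⟨x, hx, ?_⟩
      by_cases hxA : (x : X) ∈ Metric.thickening (δ A) (A : Set X)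
      · exact (hh A x hxA).symm
      · rw [hk A x hxA]
        refine (hid x fun C hC => hxA ?_).symm
        rwa [hdisj A C x (hBA hx) hC]
    rcases hB with hB | ⟨x, hx, rfl⟩
    · by_cases hBι : ∀ v ∈ 𝒱, ¬ B ⊆ v
      · let A : ι := ⟨B, hB, hBW, hBι⟩
        obtain ⟨b, hb⟩ := hne B hB
        have hself : ∀ r > 0, B ⊆ Metric.thickening r B := fun r hr =>
          Metric.self_subset_thickening hr B
        exact hsmall A (hself _ (by linarith [hε A])) ⟨b, hb, hself _ (hδ A) hb⟩ (hkA A)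
      · push Not at hBι
        obtain ⟨v, hv, hBv⟩ := hBι
        by_cases hmeet : ∃ A : ι, (B ∩ Metric.thickening (δ A) (A : Set X)).Nonempty
        · obtain ⟨A, hA⟩ := hmeet
          have hBA : B ≠ A := by
            rintro rfl
            exact A.2.2.2 v hv hBv
          obtain ⟨hs, hks⟩ := hkB A B hB hBA hA
          refine hsmall A ?_ hA hks
          obtain ⟨y, hyB, hyA⟩ := hA
          obtain ⟨a, ha, hya⟩ := Metric.mem_thickening_iff.1 hyA
          intro z hz
          refine Metric.mem_thickening_iff.2 ⟨a, ha, ?_⟩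
          have := hs.subset_ball hyB (hya.trans_le (hδε A)) hz
          rw [two_mul]
          exact this
        · refine ⟨v, hv, ?_⟩
          rintro _ ⟨_, ⟨x, hx, rfl⟩, rfl⟩
          push Not at hmeet
          change (h x : X) ∈ v
          rw [hid x fun A hA => (Set.eq_empty_iff_forall_notMem.1 (hmeet A)) x ⟨hx, hA⟩]
          exact hBv hx
    · have hxW : x ∈ W := hBW rfl
      obtain ⟨v, hv, hxv⟩ := hcV (h ⟨x, hxW⟩).2
      refine ⟨v, hv, ?_⟩
      rintro _ ⟨_, ⟨y, hy, rfl⟩, rfl⟩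
      have : y = ⟨x, hxW⟩ := Subtype.ext hy
      rwa [this]

/-! ### Inductive construction of a shrinkable family -/

/-- An `r`-separated family `s.1` of members of `𝒦` lying in `U`, together with an
equicontinuous set `s.2` of homeomorphisms. -/
def IsStage {X : Type*} [MetricSpace X] (𝒦 : Set (Set X)) (U : Set X) (r : ℝ)
    (s : Set (Set X) × Set (X ≃ₜ X)) : Prop :=
  s.1 ⊆ 𝒦 ∧ (∀ A ∈ s.1, A ⊆ U) ∧
    (∀ A ∈ s.1, ∀ B ∈ s.1, A ≠ B → ∀ a ∈ A, ∀ b ∈ B, r ≤ dist a b) ∧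
    ∀ x : X, ∀ ε > 0, ∃ δ > 0, ∀ h ∈ s.2, ∀ y ∈ Metric.ball x δ, dist (h y) (h x) < ε

/-- The stage `t` extends `s` by pieces that are small with respect to `s.2`, and by
homeomorphisms shrinking the pieces of `t`; the pieces of `t` are `2 * r`-dense in `U`. -/
def StageStep {X : Type*} [MetricSpace X] (U : Set X) (r : ℝ)
    (s t : Set (Set X) × Set (X ≃ₜ X)) : Prop :=
  s.1 ⊆ t.1 ∧ s.2 ⊆ t.2 ∧
    (∀ B ∈ t.1, B ∉ s.1 → SmallSet r B ∧ ∀ h ∈ s.2, SmallSet r (h '' B)) ∧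
    (∀ A ∈ t.1, ∃ h ∈ t.2, (∀ x ∉ Metric.thickening (r / 8) A, h x = x) ∧
      SmallSet r (h '' A)) ∧
    ∀ x ∈ U, ∃ A ∈ t.1, ∃ a ∈ A, dist x a < 2 * r

theorem exists_maximal_separated {X : Type*} [MetricSpace X] (T : Set X) {r : ℝ} (hr : 0 < r) :
    ∃ E ⊆ T, (∀ x ∈ E, ∀ y ∈ E, x ≠ y → r ≤ dist x y) ∧ ∀ x ∈ T, ∃ e ∈ E, dist x e < r := by
  obtain ⟨E, hE⟩ := zorn_subset {E : Set X | E ⊆ T ∧ ∀ x ∈ E, ∀ y ∈ E, x ≠ y → r ≤ dist x y} (by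
    intro c hc hchain
    refine ⟨⋃₀ c, ⟨sUnion_subset fun E hE => (hc hE).1, ?_⟩, fun E hE => subset_sUnion_of_mem hE⟩
    rintro x ⟨E, hE, hx⟩ y ⟨F, hF, hy⟩ hxy
    rcases hchain.total hE hF with h | h
    · exact (hc hF).2 x (h hx) y hy hxy
    · exact (hc hE).2 x hx y (h hy) hxy)
  refine ⟨E, hE.prop.1, hE.prop.2, fun x hx => ?_⟩
  by_contra hfar
  push Not at hfar
  have hins : insert x E ⊆ E := by
    refine hE.le_of_ge ⟨insert_subset hx hE.prop.1, ?_⟩ (subset_insert x E)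
    rintro y (rfl | hy) z (rfl | hz) hyz
    · exact absurd rfl hyz
    · exact hfar z hz
    · rw [dist_comm]
      exact hfar y hy
    · exact hE.prop.2 y hy z hz hyz
  have := hfar x (hins (mem_insert x E))
  rw [dist_self] at this
  linarith

theorem IsTameFamily.exists_shrink {X : Type*} [MetricSpace X] {𝒦 : Set (Set X)}
    (h𝒦 : IsTameFamily 𝒦) {A : Set X} (hA : A ∈ 𝒦) {δ ε : ℝ} (hδ : 0 < δ) (hε : 0 < ε) :
    ∃ h : X ≃ₜ X, (∀ x ∉ Metric.thickening δ A, h x = x) ∧ SmallSet ε (h '' A) := by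
  obtain ⟨h, hh, v, ⟨x, rfl⟩, hv⟩ := h𝒦.2.2.1 A hA (Metric.thickening δ A)
    Metric.isOpen_thickening (Metric.self_subset_thickening hδ A)
    (range fun x => Metric.ball x (ε / 2) ∩ Metric.thickening δ A)
    (by
      rintro _ ⟨x, rfl⟩
      exact ⟨Metric.isOpen_ball.inter Metric.isOpen_thickening, inter_subset_right⟩)
    (fun x hx => ⟨_, ⟨x, rfl⟩, Metric.mem_ball_self (half_pos hε), hx⟩)
  refine ⟨h, hh, fun y hy z hz => ?_⟩
  have h1 : dist y x < ε / 2 := (hv hy).1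
  have h2 : dist z x < ε / 2 := (hv hz).1
  linarith [dist_triangle_right y z x]

theorem exists_stageStep {X : Type*} [MetricSpace X] {𝒦 : Set (Set X)} (h𝒦 : IsTameFamily 𝒦)
    (hnt : ∀ K ∈ 𝒦, ¬ K.Subsingleton) {U : Set X} (hU : IsOpen U) {r : ℝ} (hr : 0 < r)
    {s : Set (Set X) × Set (X ≃ₜ X)} (hs : IsStage 𝒦 U r s) :
    ∃ t, IsStage 𝒦 U (r / 2) t ∧ StageStep U r s t := by
  obtain ⟨hsK, hsU, hsep, hequi⟩ := hs
  obtain ⟨E, hET, hEsep, hEmax⟩ := exists_maximal_separated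
    {x | x ∈ U ∧ ∀ A ∈ s.1, ∀ a ∈ A, r ≤ dist x a} hr
  have hK : ∀ e : E, ∃ K ∈ 𝒦, K ⊆ U ∧ K ⊆ Metric.ball (e : X) (r / 4) ∧
      ∀ h ∈ s.2, SmallSet r (h '' K) := by
    intro e
    obtain ⟨δ, hδ, h⟩ := hequi e (r / 2) (half_pos hr)
    have hne : (U ∩ (Metric.ball (e : X) (r / 4) ∩ Metric.ball (e : X) δ)).Nonempty :=
      ⟨e, (hET e.2).1, Metric.mem_ball_self (by positivity), Metric.mem_ball_self hδ⟩
    obtain ⟨K, hK, hsub⟩ := h𝒦.2.2.2.2 _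
      (hU.inter (Metric.isOpen_ball.inter Metric.isOpen_ball)) hne
    refine ⟨K, hK, fun x hx => (hsub hx).1, fun x hx => (hsub hx).2.1, ?_⟩
    rintro g hg _ ⟨x, hx, rfl⟩ _ ⟨y, hy, rfl⟩
    linarith [h g hg x (hsub hx).2.2, h g hg y (hsub hy).2.2,
      dist_triangle_right (g x) (g y) (g e)]
  choose K hKK hKU hKb hKh using hK
  have hF : s.1 ∪ range K ⊆ 𝒦 := by
    rintro A (hA | ⟨e, rfl⟩)
    · exact hsK hA
    · exact hKK e
  have hold : ∀ A ∈ s.1, ∀ e : E, ∀ a ∈ A, ∀ b ∈ K e, r / 2 ≤ dist a b := by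
    intro A hA e a ha b hb
    have h1 := (hET e.2).2 A hA a ha
    have h2 : dist b e < r / 4 := hKb e hb
    have h3 := dist_triangle_left (e : X) a b
    rw [dist_comm b a] at h3
    linarith
  have hsep' : ∀ A ∈ s.1 ∪ range K, ∀ B ∈ s.1 ∪ range K, A ≠ B →
      ∀ a ∈ A, ∀ b ∈ B, r / 2 ≤ dist a b := by
    rintro A (hA | ⟨e, rfl⟩) B (hB | ⟨f, rfl⟩) hAB a ha b hb
    · linarith [hsep A hA B hB hAB a ha b hb]
    · exact hold A hA f a ha b hb
    · rw [dist_comm]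
      exact hold B hB e b hb a ha
    · have hef : (e : X) ≠ f := fun h => hAB (by rw [Subtype.ext h])
      have h1 := hEsep e e.2 f f.2 hef
      have h2 : dist a e < r / 4 := hKb e ha
      have h3 : dist b f < r / 4 := hKb f hb
      have h4 := dist_triangle4 (e : X) a b f
      rw [dist_comm (e : X) a] at h4
      linarith
  have hsh : ∀ A : ↥(s.1 ∪ range K), ∃ h : X ≃ₜ X,
      (∀ x ∉ Metric.thickening (r / 8) (A : Set X), h x = x) ∧ SmallSet r (h '' A) :=
    fun A => h𝒦.exists_shrink (hF A.2) (by positivity) hr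
  choose g hg hgA using hsh
  refine ⟨(s.1 ∪ range K, s.2 ∪ range g), ⟨hF, ?_, hsep', ?_⟩,
    subset_union_left, subset_union_left, ?_, ?_, ?_⟩
  · rintro A (hA | ⟨e, rfl⟩)
    · exact hsU A hA
    · exact hKU e
  · intro x ε hε
    obtain ⟨δ₁, hδ₁, h₁⟩ := hequi x ε hε
    -- at most one of the new homeomorphisms moves points near `x`
    have hnew : ∃ δ > 0, ∀ A, ∀ y ∈ Metric.ball x δ, dist (g A y) (g A x) < ε := by
      have hid : ∀ A : ↥(s.1 ∪ range K),
          ¬ (Metric.ball x (r / 8) ∩ Metric.thickening (r / 8) (A : Set X)).Nonempty →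
          ∀ y ∈ Metric.ball x (min ε (r / 8)), dist (g A y) (g A x) < ε := by
        intro A hA y hy
        have hy' := Metric.ball_subset_ball (min_le_right _ _) hy
        rw [hg A y fun h => hA ⟨y, hy', h⟩,
          hg A x fun h => hA ⟨x, Metric.mem_ball_self (by positivity), h⟩]
        exact lt_of_lt_of_le hy (min_le_left _ _)
      by_cases hex : ∃ A : ↥(s.1 ∪ range K),
          (Metric.ball x (r / 8) ∩ Metric.thickening (r / 8) (A : Set X)).Nonempty
      · obtain ⟨A, hA⟩ := hex
        obtain ⟨δ, hδ, h⟩ := Metric.continuousAt_iff.1 (g A).continuous.continuousAt ε hε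
        refine ⟨min δ (min ε (r / 8)), by positivity, fun B y hy => ?_⟩
        by_cases hBA : B = A
        · rw [hBA]
          exact h (lt_of_lt_of_le hy (min_le_left _ _))
        · refine hid B ?_ y (Metric.ball_subset_ball (min_le_right _ _) hy)
          rintro ⟨z, hzx, hzB⟩
          obtain ⟨w, hwx, hwA⟩ := hA
          obtain ⟨a, ha, hwa⟩ := Metric.mem_thickening_iff.1 hwA
          obtain ⟨b, hb, hzb⟩ := Metric.mem_thickening_iff.1 hzB
          have h1 := hsep' B B.2 A A.2 (fun h => hBA (Subtype.ext h)) b hb a ha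
          have h2 := dist_triangle4 b z x a
          have h3 := dist_triangle x w a
          rw [Metric.mem_ball] at hzx
          rw [Metric.mem_ball'] at hwx
          rw [dist_comm b z] at h2
          linarith
      · push Not at hex
        refine ⟨min ε (r / 8), by positivity, fun B y hy => hid B ?_ y hy⟩
        rw [hex B]
        exact not_nonempty_empty
    obtain ⟨δ₂, hδ₂, h₂⟩ := hnew
    refine ⟨min δ₁ δ₂, lt_min hδ₁ hδ₂, ?_⟩
    rintro h (hh | ⟨A, rfl⟩) y hy
    · exact h₁ h hh y (Metric.ball_subset_ball (min_le_left _ _) hy)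
    · exact h₂ A y (Metric.ball_subset_ball (min_le_right _ _) hy)
  · rintro B (hB | ⟨e, rfl⟩) hBs
    · exact absurd hB hBs
    · refine ⟨fun x hx y hy => ?_, hKh e⟩
      have h1 : dist x e < r / 4 := hKb e hx
      have h2 : dist y e < r / 4 := hKb e hy
      linarith [dist_triangle_right x y (e : X)]
  · intro A hA
    exact ⟨g ⟨A, hA⟩, Or.inr ⟨⟨A, hA⟩, rfl⟩, hg ⟨A, hA⟩, hgA ⟨A, hA⟩⟩
  · intro x hx
    by_cases hxT : ∀ A ∈ s.1, ∀ a ∈ A, r ≤ dist x a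
    · obtain ⟨e, he, hxe⟩ := hEmax x ⟨hx, hxT⟩
      obtain ⟨a, ha⟩ : (K ⟨e, he⟩).Nonempty := by
        by_contra hempty
        exact hnt _ (hKK ⟨e, he⟩) (not_nonempty_iff_eq_empty.1 hempty ▸ subsingleton_empty)
      refine ⟨K ⟨e, he⟩, Or.inr ⟨_, rfl⟩, a, ha, ?_⟩
      have h1 : dist a e < r / 4 := hKb ⟨e, he⟩ ha
      linarith [dist_triangle_right x a e]
    · push Not at hxT
      obtain ⟨A, hA, a, ha, hxa⟩ := hxT
      exact ⟨A, Or.inl hA, a, ha, by linarith⟩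

theorem exists_stages {X : Type*} [MetricSpace X] {𝒦 : Set (Set X)} (h𝒦 : IsTameFamily 𝒦)
    (hnt : ∀ K ∈ 𝒦, ¬ K.Subsingleton) {U : Set X} (hU : IsOpen U) :
    ∃ s : ℕ → Set (Set X) × Set (X ≃ₜ X), ∀ n, IsStage 𝒦 U ((1 / 2) ^ n) (s n) ∧
      StageStep U ((1 / 2) ^ n) (s n) (s (n + 1)) := by
  have hstep : ∀ n : ℕ, ∀ s, IsStage 𝒦 U ((1 / 2) ^ n) s →
      ∃ t, IsStage 𝒦 U ((1 / 2) ^ (n + 1)) t ∧ StageStep U ((1 / 2) ^ n) s t := by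
    intro n s hs
    obtain ⟨t, ht, hst⟩ := exists_stageStep h𝒦 hnt hU (by positivity) hs
    exact ⟨t, by rw [pow_succ, mul_one_div]; exact ht, hst⟩
  choose! f hf hfs using hstep
  let s : ℕ → Set (Set X) × Set (X ≃ₜ X) := fun n => Nat.rec (∅, ∅) f n
  have hs : ∀ n, IsStage 𝒦 U ((1 / 2) ^ n) (s n) := by
    intro n
    induction n with
    | zero =>
      exact ⟨empty_subset _, by simp [s], by simp [s], fun _ _ _ => ⟨1, one_pos, by simp [s]⟩⟩
    | succ n ih => exact hf n _ ih
  exact ⟨s, fun n => ⟨hs n, hfs n _ (hs n)⟩⟩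

theorem exists_dense_shrinkableFamily {X : Type*} [MetricSpace X] {𝒦 : Set (Set X)}
    (h𝒦 : IsTameFamily 𝒦) (hnt : ∀ K ∈ 𝒦, ¬ K.Subsingleton) {U : Set X} (hU : IsOpen U) :
    ∃ P ⊆ 𝒦, (∀ A ∈ P, ∀ B ∈ P, A ≠ B → Disjoint A B) ∧ ⋃₀ P ⊆ U ∧ U ⊆ closure (⋃₀ P) ∧
      SeparatedLarge P ∧ ShrinkableFamily P := by
  obtain ⟨s, hs⟩ := exists_stages h𝒦 hnt hU
  have hmono₁ : Monotone fun n => (s n).1 := monotone_nat_of_le_succ fun n => (hs n).2.1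
  have hmono₂ : Monotone fun n => (s n).2 := monotone_nat_of_le_succ fun n => (hs n).2.2.1
  have hpow : ∀ ε > (0 : ℝ), ∃ n : ℕ, (1 / 2 : ℝ) ^ n < ε :=
    fun ε hε => exists_pow_lt_of_lt_one hε (by norm_num)
  have hanti : ∀ {m n : ℕ}, m ≤ n → (1 / 2 : ℝ) ^ n ≤ (1 / 2) ^ m :=
    fun h => pow_le_pow_of_le_one (by norm_num) (by norm_num) h
  -- a piece that is not present at stage `n` is small with respect to stage `n`
  have hlate : ∀ n, ∀ B ∈ ⋃ n, (s n).1, B ∉ (s n).1 →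
      SmallSet ((1 / 2) ^ n) B ∧ ∀ h ∈ (s n).2, SmallSet ((1 / 2) ^ n) (h '' B) := by
    intro n B hB hBn
    obtain ⟨m, hm⟩ := mem_iUnion.1 hB
    induction m with
    | zero => exact absurd (hmono₁ (Nat.zero_le n) hm) hBn
    | succ m ih =>
      by_cases hBm : B ∈ (s m).1
      · exact ih hBm
      · have hnm : n ≤ m := by
          by_contra hlt
          exact hBn (hmono₁ (show m + 1 ≤ n by omega) hm)
        obtain ⟨h1, h2⟩ := (hs m).2.2.2.1 B hm hBm
        exact ⟨h1.mono (hanti hnm), fun h hh => (h2 h (hmono₂ hnm hh)).mono (hanti hnm)⟩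
  refine ⟨⋃ n, (s n).1, iUnion_subset fun n => (hs n).1.1, ?_, ?_, ?_, ?_, ?_⟩
  · intro A hA B hB hAB
    obtain ⟨m, hm⟩ := mem_iUnion.1 hA
    obtain ⟨n, hn⟩ := mem_iUnion.1 hB
    refine disjoint_left.2 fun x hxA hxB => ?_
    have h1 := (hs (max m n)).1.2.2.1 A (hmono₁ (le_max_left m n) hm) B
      (hmono₁ (le_max_right m n) hn) hAB x hxA x hxB
    rw [dist_self] at h1
    exact absurd h1 (not_le.2 (by positivity))
  · rintro x ⟨A, hA, hx⟩
    obtain ⟨n, hn⟩ := mem_iUnion.1 hA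
    exact (hs n).1.2.1 A hn hx
  · intro x hx
    refine Metric.mem_closure_iff.2 fun ε hε => ?_
    obtain ⟨n, hn⟩ := hpow (ε / 2) (half_pos hε)
    obtain ⟨A, hA, a, ha, hxa⟩ := (hs n).2.2.2.2.2 x hx
    exact ⟨a, ⟨A, mem_iUnion.2 ⟨n + 1, hA⟩, ha⟩, by linarith⟩
  · intro ε hε
    obtain ⟨n, hn⟩ := hpow ε hε
    refine ⟨(1 / 2) ^ n, by positivity, fun A hA B hB hAs hBs hAB => ?_⟩
    have key : ∀ C ∈ ⋃ n, (s n).1, ¬ SmallSet ε C → C ∈ (s n).1 := by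
      intro C hC hCs
      by_contra hCn
      exact hCs ((hlate n C hC hCn).1.mono hn.le)
    exact (hs n).1.2.2.1 A (key A hA hAs) B (key B hB hBs) hAB
  · intro A hA ε hε
    obtain ⟨m, hm⟩ := mem_iUnion.1 hA
    obtain ⟨n', hn'⟩ := hpow ε hε
    obtain ⟨n, hmn, hn⟩ : ∃ n ≥ m, (1 / 2 : ℝ) ^ n < ε :=
      ⟨max m n', le_max_left _ _, (hanti (le_max_right _ _)).trans_lt hn'⟩
    have hAn : A ∈ (s (n + 1)).1 := hmono₁ (show m ≤ n + 1 by omega) hm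
    obtain ⟨h, hh, hsupp, hsmall⟩ := (hs n).2.2.2.2.1 A hAn
    have hpos : (0 : ℝ) < (1 / 2) ^ n := by positivity
    refine ⟨h, (1 / 2) ^ n / 8, by positivity, by linarith, hsupp, hsmall.mono hn.le, ?_⟩
    rintro B hB hBA ⟨b, hbB, hbA⟩
    have hBn : B ∉ (s (n + 1)).1 := by
      intro hBn
      obtain ⟨a, ha, hba⟩ := Metric.mem_thickening_iff.1 hbA
      have h1 := (hs (n + 1)).1.2.2.1 B hBn A hAn hBA b hbB a ha
      rw [pow_succ] at h1
      linarith
    obtain ⟨h1, h2⟩ := hlate (n + 1) B hB hBn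
    have hle : (1 / 2 : ℝ) ^ (n + 1) ≤ ε := (hanti (Nat.le_succ n)).trans hn.le
    exact ⟨h1.mono hle, (h2 h hh).mono hle⟩

/-- Theorem: existence of `𝒦`-tame decompositions whose non-degenerate part is dense in a
given open set. -/
theorem exists_KTame_decomposition (X : Type*) [TopologicalSpace X]
    (hX : CompletelyMetrizable X) (𝒦 : Set (Set X)) (h𝒦 : IsTameFamily 𝒦)
    (hnt : ∀ K ∈ 𝒦, ¬ K.Subsingleton) (U : Set X) (hU : IsOpen U) :
    ∃ D : Decomposition X, D.KTame 𝒦 ∧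
      D.nondegUnion ⊆ U ∧ U ⊆ closure D.nondegUnion := by
  obtain ⟨m, rfl, -⟩ := hX
  obtain ⟨P, hPK, hdisj, hPU, hUP, hsep, hshr⟩ := exists_dense_shrinkableFamily h𝒦 hnt hU
  have hne : ∀ A ∈ P, A.Nonempty := by
    intro A hA
    by_contra hempty
    exact hnt A (hPK hA) (not_nonempty_iff_eq_empty.1 hempty ▸ subsingleton_empty)
  let D := Decomposition.ofFamily P hne (fun A hA => h𝒦.1 A (hPK hA)) hdisj
  have hmem : ∀ A, A ∈ D.pieces ∧ ¬ A.Subsingleton ↔ A ∈ P := by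
    intro A
    constructor
    · rintro ⟨hA | ⟨x, -, rfl⟩, hA'⟩
      · exact hA
      · exact absurd subsingleton_singleton hA'
    · exact fun hA => ⟨Or.inl hA, hnt A (hPK hA)⟩
  have hunion : D.nondegUnion = ⋃₀ P := by
    unfold Decomposition.nondegUnion
    congr 1
    exact Set.ext hmem
  refine ⟨D, ⟨Decomposition.vanishing_ofFamily hsep,
    Decomposition.stronglyShrinkable_ofFamily hsep hshr,
    fun A hA hA' => hPK ((hmem A).1 ⟨hA, hA'⟩)⟩, ?_, ?_⟩
  · rwa [hunion]
  · rwa [hunion]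

end
end
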